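/- arXiv:1509.00546 — 8 statements merged into one kernel-verified Lean document; each statement's English description precedes it below -/
import Mathlib

section
/- Let n ≥ 2 and let Ω ⊂ ℝⁿ be an open set with nonempty boundary. Let x ∈ Ω \ Σ̄ with π(x) = {ξ}, and suppose the point ξ ∈ ∂Ω has non-spreading inner perpendicular. Then there exist δ > 0 and r_δ > 0 such that d(x) + δ ≤ ρ(η) for every η ∈ B_{r_δ}(ξ) ∩ ∂Ω. In particular d(x) < ρ*(ξ). -/
open Set Metric Filter
open scoped RealInnerProductSpace ENNReal Topology

noncomputable section

/-- The metric projection of `x` onto the boundary of `Ω`: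
the set of boundary points realizing the distance from `x` to `∂Ω`. -/
def mproj {n : ℕ} (Ω : Set (EuclideanSpace ℝ (Fin n))) (x : EuclideanSpace ℝ (Fin n)) :
    Set (EuclideanSpace ℝ (Fin n)) :=
  {ξ | ξ ∈ frontier Ω ∧ dist x ξ = Metric.infDist x (frontier Ω)}

/-- The skeleton (medial axis) of `Ω`: points where the metric projection is not a singleton. -/
def skel {n : ℕ} (Ω : Set (EuclideanSpace ℝ (Fin n))) : Set (EuclideanSpace ℝ (Fin n)) :=
  {x | x ∈ Ω ∧ ¬ ∃ ξ, mproj Ω x = {ξ}}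

/-- The cut locus (ridge): the closure of the skeleton in `Ω`. -/
def cutLocus {n : ℕ} (Ω : Set (EuclideanSpace ℝ (Fin n))) : Set (EuclideanSpace ℝ (Fin n)) :=
  Ω ∩ closure (skel Ω)

/-- `Metric.ball z r` is a locally inner touching ball at `ξ ∈ ∂Ω`. -/
def InnerTouchBall {n : ℕ} (Ω : Set (EuclideanSpace ℝ (Fin n))) (ξ z : EuclideanSpace ℝ (Fin n))
    (r : ℝ) : Prop :=
  0 < r ∧ dist ξ z = r ∧ ∃ U ∈ 𝓝 ξ, Metric.ball z r ∩ U ⊆ Ω ∩ U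

/-- The radius of inner curvature at `ξ ∈ ∂Ω`: the supremum of radii of locally inner
touching balls at `ξ` (`0` if there is none, `∞` if the radii are unbounded). -/
def rho {n : ℕ} (Ω : Set (EuclideanSpace ℝ (Fin n))) (ξ : EuclideanSpace ℝ (Fin n)) : ℝ≥0∞ :=
  ⨆ (r : ℝ) (z : EuclideanSpace ℝ (Fin n)) (_ : InnerTouchBall Ω ξ z r), ENNReal.ofReal r

/-- The lower semicontinuous envelope of `rho` along `∂Ω`:
`ρ*(ξ) = lim_{ε↓0} inf {ρ(η) : η ∈ B_ε(ξ) ∩ ∂Ω}` (the limit of a monotone quantity,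
hence the supremum over `ε > 0`). -/
def rhoStar {n : ℕ} (Ω : Set (EuclideanSpace ℝ (Fin n))) (ξ : EuclideanSpace ℝ (Fin n)) :
    ℝ≥0∞ :=
  ⨆ (ε : ℝ) (_ : 0 < ε),
    ⨅ (η : EuclideanSpace ℝ (Fin n)) (_ : η ∈ Metric.ball ξ ε ∩ frontier Ω), rho Ω η

/-- Append a last coordinate to a point of `ℝ^m`, producing a point of `ℝ^{m+1}`. -/
def snocE (m : ℕ) (z : EuclideanSpace ℝ (Fin m)) (t : ℝ) : EuclideanSpace ℝ (Fin (m + 1)) :=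
  (WithLp.equiv 2 (Fin (m + 1) → ℝ)).symm (Fin.snoc ((WithLp.equiv 2 (Fin m → ℝ)) z) t)

/-- `∂Ω` is of class `C¹`: near every boundary point, in some orthonormal coordinate
system (i.e. after a rigid motion, realized by an isometry of Euclidean space),
`∂Ω` is the graph of a `C¹` function on an open ball of `ℝ^{n-1}`. -/
def IsC1Boundary (m : ℕ) (Ω : Set (EuclideanSpace ℝ (Fin (m + 1)))) : Prop :=
  ∀ ξ ∈ frontier Ω, ∃ U ∈ 𝓝 ξ,
    ∃ (A : EuclideanSpace ℝ (Fin (m + 1)) ≃ᵢ EuclideanSpace ℝ (Fin (m + 1)))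
      (ε : ℝ) (g : EuclideanSpace ℝ (Fin m) → ℝ),
      0 < ε ∧ ContDiffOn ℝ 1 g (Metric.ball 0 ε) ∧
      frontier Ω ∩ U = (fun z => A.symm (snocE m z (g z))) '' Metric.ball 0 ε

/-- `Γ` is locally represented near `η` as a graph in the direction of the vector `v`,
i.e. as the graph of a function over the hyperplane orthogonal to `v`. -/
def IsGraphInDirection {n : ℕ} (Γ : Set (EuclideanSpace ℝ (Fin n)))
    (η v : EuclideanSpace ℝ (Fin n)) : Prop :=
  ∃ U ∈ 𝓝 η, ∃ (D : Set (EuclideanSpace ℝ (Fin n))) (g : EuclideanSpace ℝ (Fin n) → ℝ),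
    (∀ z ∈ D, ⟪z, v⟫ = 0) ∧ Γ ∩ U = (fun z => z + g z • v) '' D

/-- `η ∈ ∂Ω` has non-spreading inner perpendicular: either the pull-back
`π⁻¹({η}) = {y ∈ Ω : π(y) = {η}}` is empty, or it is contained in a line `L` and `∂Ω`
is locally a graph near `η` in the direction of `L`. -/
def NonSpreadingPerp {n : ℕ} (Ω : Set (EuclideanSpace ℝ (Fin n)))
    (η : EuclideanSpace ℝ (Fin n)) : Prop :=
  {y | y ∈ Ω ∧ mproj Ω y = {η}} = ∅ ∨
    ∃ p v : EuclideanSpace ℝ (Fin n), v ≠ 0 ∧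
      {y | y ∈ Ω ∧ mproj Ω y = {η}} ⊆ {w | ∃ t : ℝ, w = p + t • v} ∧
      IsGraphInDirection (frontier Ω) η v

/-- The upper semicircle of radius `r` centered at `(c₁, c₂)`, as a function of `t`. -/
def semicircle (c₁ c₂ r t : ℝ) : ℝ := c₂ + Real.sqrt (r ^ 2 - (t - c₁) ^ 2)

section Projection

variable {n : ℕ} {Ω : Set (EuclideanSpace ℝ (Fin n))}

theorem mproj_nonempty (hne : (frontier Ω).Nonempty) (y : EuclideanSpace ℝ (Fin n)) :
    (mproj Ω y).Nonempty := by
  obtain ⟨ζ, hζ, h⟩ := isClosed_frontier.exists_infDist_eq_dist hne y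
  exact ⟨ζ, hζ, h.symm⟩

/-- The metric projection is upper semicontinuous at points where it is single valued. -/
theorem eventually_mproj_subset {y ζ : EuclideanSpace ℝ (Fin n)} (hy : mproj Ω y = {ζ})
    {V : Set (EuclideanSpace ℝ (Fin n))} (hV : V ∈ 𝓝 ζ) : ∀ᶠ y' in 𝓝 y, mproj Ω y' ⊆ V := by
  obtain ⟨W, hWV, hWo, hζW⟩ := _root_.mem_nhds_iff.1 hV
  set d := infDist y (frontier Ω) with hd
  have hK : IsCompact ((closedBall y (d + 2) ∩ frontier Ω) \ W) :=
    ((isCompact_closedBall y _).inter_right isClosed_frontier).diff hWo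
  obtain ⟨m, hm, hmK⟩ : ∃ m > 0, ∀ z ∈ (closedBall y (d + 2) ∩ frontier Ω) \ W,
      d + m ≤ dist y z := by
    rcases ((closedBall y (d + 2) ∩ frontier Ω) \ W).eq_empty_or_nonempty with h | h
    · exact ⟨1, one_pos, by simp [h]⟩
    · obtain ⟨z, hz, hmin⟩ := hK.exists_isMinOn h
        (f := fun z => dist y z) (by fun_prop)
      refine ⟨dist y z - d, ?_, fun w hw => ?_⟩
      · have h1 : d ≤ dist y z := infDist_le_dist_of_mem hz.1.2
        refine sub_pos.2 (lt_of_le_of_ne h1 fun h2 => hz.2 ?_)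
        have h3 : z ∈ mproj Ω y := ⟨hz.1.2, h2.symm⟩
        rw [hy, mem_singleton_iff] at h3
        exact h3 ▸ hζW
      · have h2 : dist y z ≤ dist y w := hmin hw
        linarith
  have hpos : 0 < min 1 (m / 2) := lt_min one_pos (half_pos hm)
  filter_upwards [ball_mem_nhds y hpos] with y' hy' z hz
  rw [mem_ball] at hy'
  have h1 := (hy'.trans_le (min_le_left _ _)).le
  have h2 := hy'.trans_le (min_le_right _ _)
  have h3 : infDist y' (frontier Ω) ≤ d + dist y' y := infDist_le_infDist_add_dist
  have h4 := dist_triangle_left y z y'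
  have h5 := hz.2
  by_contra hzV
  have := hmK z ⟨⟨by rw [mem_closedBall, dist_comm]; linarith, hz.1⟩, fun h => hzV (hWV h)⟩
  linarith

/-- Where the projection is single valued, the distance function grows at unit rate in the
direction away from the projection. -/
theorem not_eventually_infDist_le (hne : (frontier Ω).Nonempty) {y ζ : EuclideanSpace ℝ (Fin n)}
    (hy : mproj Ω y = {ζ}) (hpos : 0 < infDist y (frontier Ω)) {c : ℝ} (hc0 : 0 ≤ c)
    (hc : c < 1) :
    ¬ ∀ᶠ z in 𝓝 y, infDist z (frontier Ω) ≤ infDist y (frontier Ω) + c * dist z y := by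
  intro hev
  have hζ : ζ ∈ mproj Ω y := by simp [hy]
  set d := infDist y (frontier Ω) with hd
  have hed : ‖y - ζ‖ = d := by rw [← dist_eq_norm]; exact hζ.2
  have hV : {z | c * d ^ 2 < ⟪y - ζ, y - z⟫} ∈ 𝓝 ζ := by
    refine IsOpen.mem_nhds (isOpen_lt (by fun_prop) (by fun_prop)) ?_
    rw [mem_ofPred_eq, real_inner_self_eq_norm_sq, hed]
    nlinarith [pow_pos hpos 2]
  have hlim : Tendsto (fun t : ℝ => y + t • (y - ζ)) (𝓝[>] 0) (𝓝 y) := by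
    have : Continuous fun t : ℝ => y + t • (y - ζ) := by fun_prop
    simpa using (this.tendsto 0).mono_left (nhdsWithin_le_nhds (s := Ioi 0))
  obtain ⟨t, ht, h1, h2⟩ := ((eventually_mem_nhdsWithin (s := Ioi (0 : ℝ)) (a := 0)).and
    (hlim.eventually (hev.and (eventually_mproj_subset hy hV)))).exists
  rw [mem_Ioi] at ht
  obtain ⟨z, hz⟩ := mproj_nonempty hne (y + t • (y - ζ))
  have h3 : c * d ^ 2 < ⟪y - ζ, y - z⟫ := h2 hz
  rw [← hz.2, dist_eq_norm, dist_eq_norm, add_sub_cancel_left, norm_smul, hed,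
    Real.norm_of_nonneg ht.le] at h1
  have h4 : ‖y + t • (y - ζ) - z‖ ^ 2 = ‖y - z‖ ^ 2 + 2 * (t * ⟪y - ζ, y - z⟫)
      + t ^ 2 * d ^ 2 := by
    rw [show y + t • (y - ζ) - z = (y - z) + t • (y - ζ) by abel, norm_add_sq_real,
      inner_smul_right, real_inner_comm, norm_smul, mul_pow, hed, Real.norm_eq_abs, sq_abs]
  have h5 : d ≤ ‖y - z‖ := by rw [← dist_eq_norm]; exact infDist_le_dist_of_mem hz.1
  have h6 : d ^ 2 ≤ ‖y - z‖ ^ 2 := pow_le_pow_left₀ hpos.le h5 2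
  have h7 := pow_le_pow_left₀ (norm_nonneg _) h1 2
  have h8 : t * (c * d ^ 2) < t * ⟪y - ζ, y - z⟫ := mul_lt_mul_of_pos_left h3 ht
  have h9 : c ^ 2 * (t * d) ^ 2 ≤ (t * d) ^ 2 :=
    mul_le_of_le_one_left (sq_nonneg _) (pow_le_one₀ hc0 hc.le)
  nlinarith

/-- Normal segments can be extended inside a ball on which the projection is single valued. -/
theorem exists_infDist_eq_add (hne : (frontier Ω).Nonempty) {x : EuclideanSpace ℝ (Fin n)} {s : ℝ}
    (hs : 0 ≤ s) (hpos : ∀ y ∈ closedBall x s, 0 < infDist y (frontier Ω))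
    (hsing : ∀ y ∈ closedBall x s, ∃ ζ, mproj Ω y = {ζ}) :
    ∃ y ∈ closedBall x s, infDist y (frontier Ω) = infDist x (frontier Ω) + s := by
  have hcd : Continuous fun y => infDist y (frontier Ω) := continuous_infDist_pt _
  have hne' : (closedBall x s).Nonempty := ⟨x, mem_closedBall_self hs⟩
  obtain ⟨y, hy, hmax⟩ := (isCompact_closedBall x s).exists_isMaxOn hne' hcd.continuousOn
  have hmax : ∀ z ∈ closedBall x s, infDist z (frontier Ω) ≤ infDist y (frontier Ω) := hmax
  refine ⟨y, hy, le_antisymm ?_ ?_⟩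
  · have h1 : infDist y (frontier Ω) ≤ infDist x (frontier Ω) + dist y x :=
      infDist_le_infDist_add_dist
    have h2 := mem_closedBall.1 hy
    linarith
  have key : ∀ c ∈ Ico (0 : ℝ) 1,
      infDist x (frontier Ω) + c * s ≤ infDist y (frontier Ω) := by
    rintro c ⟨hc0, hc1⟩
    obtain ⟨w, hw, hwmax⟩ := (isCompact_closedBall x s).exists_isMaxOn hne'
      (f := fun z => infDist z (frontier Ω) - c * dist z x) (by fun_prop)
    have hwmax : ∀ z ∈ closedBall x s, infDist z (frontier Ω) - c * dist z x ≤
      infDist w (frontier Ω) - c * dist w x := hwmax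
    rcases (mem_closedBall.1 hw).lt_or_eq with hlt | heq
    · obtain ⟨ζ, hζ⟩ := hsing w hw
      refine absurd ?_ (not_eventually_infDist_le hne hζ (hpos w hw) hc0 hc1)
      filter_upwards [isOpen_ball.mem_nhds (mem_ball.2 hlt)] with z hz
      have h1 := hwmax z (ball_subset_closedBall hz)
      have h2 := mul_le_mul_of_nonneg_left (dist_triangle z w x) hc0
      linarith
    · have h1 := hwmax x (mem_closedBall_self hs)
      rw [heq, dist_self] at h1
      have h2 := hmax w hw
      linarith
  have hlim : Tendsto (fun c : ℝ => infDist x (frontier Ω) + c * s) (𝓝[<] 1)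
      (𝓝 (infDist x (frontier Ω) + s)) := by
    have : Continuous fun c : ℝ => infDist x (frontier Ω) + c * s := by fun_prop
    simpa using (this.tendsto 1).mono_left (nhdsWithin_le_nhds (s := Iio 1))
  refine le_of_tendsto hlim ?_
  filter_upwards [Ico_mem_nhdsLT (zero_lt_one (α := ℝ))] with c hc using key c hc

/-- First-order condition for minimizing `z ↦ |z - η|² - d(z)²` in the direction `w`. -/
theorem inner_nonneg_of_eventually_le (hne : (frontier Ω).Nonempty)
    {y ζ η w : EuclideanSpace ℝ (Fin n)} (hy : mproj Ω y = {ζ})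
    (hmin : ∀ᶠ t in 𝓝[>] (0 : ℝ), dist y η ^ 2 - infDist y (frontier Ω) ^ 2 ≤
      dist (y + t • w) η ^ 2 - infDist (y + t • w) (frontier Ω) ^ 2) :
    0 ≤ ⟪w, ζ - η⟫ := by
  by_contra! hneg
  have hV : {z | ⟪w, z - η⟫ < 0} ∈ 𝓝 ζ :=
    IsOpen.mem_nhds (isOpen_lt (by fun_prop) (by fun_prop)) hneg
  have hlim : Tendsto (fun t : ℝ => y + t • w) (𝓝[>] 0) (𝓝 y) := by
    have : Continuous fun t : ℝ => y + t • w := by fun_prop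
    simpa using (this.tendsto 0).mono_left (nhdsWithin_le_nhds (s := Ioi 0))
  obtain ⟨t, ⟨ht, h1⟩, h2⟩ := (((eventually_mem_nhdsWithin (s := Ioi (0 : ℝ)) (a := 0)).and
    hmin).and (hlim.eventually (eventually_mproj_subset hy hV))).exists
  rw [mem_Ioi] at ht
  obtain ⟨z, hz⟩ := mproj_nonempty hne (y + t • w)
  have h3 : ⟪w, z - η⟫ < 0 := h2 hz
  have expand : ∀ a, dist (y + t • w) a ^ 2 =
      dist y a ^ 2 + 2 * (t * ⟪w, y - a⟫) + ‖t • w‖ ^ 2 := fun a => by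
    rw [dist_eq_norm, dist_eq_norm, show y + t • w - a = (y - a) + t • w by abel,
      norm_add_sq_real, inner_smul_right, real_inner_comm]
  have h4 : infDist y (frontier Ω) ^ 2 ≤ dist y z ^ 2 :=
    pow_le_pow_left₀ infDist_nonneg (infDist_le_dist_of_mem hz.1) 2
  rw [← hz.2, expand η, expand z] at h1
  have h5 : ⟪w, y - η⟫ = ⟪w, y - z⟫ + ⟪w, z - η⟫ := by
    rw [← inner_add_right, sub_add_sub_cancel]
  have h6 := mul_neg_of_pos_of_neg ht h3
  rw [h5] at h1
  nlinarith

theorem ball_infDist_frontier_subset (hΩ : IsOpen Ω) {y : EuclideanSpace ℝ (Fin n)}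
    (hy : y ∈ Ω) : ball y (infDist y (frontier Ω)) ⊆ Ω := by
  intro z hz
  by_contra hzΩ
  have hdisj : ∀ w ∈ ball y (infDist y (frontier Ω)), w ∉ frontier Ω := fun w hw hwf => by
    have h1 := infDist_le_dist_of_mem (x := y) hwf
    rw [mem_ball, dist_comm] at hw
    linarith
  have hcover : ∀ w ∈ ball y (infDist y (frontier Ω)), w ∉ Ω → w ∉ closure Ω :=
    fun w hw hwΩ hwc => hdisj w hw (hΩ.frontier_eq ▸ ⟨hwc, hwΩ⟩)
  have hpos : 0 < infDist y (frontier Ω) := dist_nonneg.trans_lt hz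
  obtain ⟨w, -, hw, hwc⟩ := (convex_ball y (infDist y (frontier Ω))).isPreconnected Ω
    (closure Ω)ᶜ hΩ isClosed_closure.isOpen_compl
    (fun w hw => (em (w ∈ Ω)).imp id (hcover w hw)) ⟨y, mem_ball_self hpos, hy⟩
    ⟨z, hz, hcover z hz hzΩ⟩
  exact hwc (subset_closure hw)

theorem ofReal_infDist_le_rho (hΩ : IsOpen Ω) {y η : EuclideanSpace ℝ (Fin n)}
    (hy : y ∈ Ω) (hpos : 0 < infDist y (frontier Ω)) (hη : η ∈ mproj Ω y) :
    ENNReal.ofReal (infDist y (frontier Ω)) ≤ rho Ω η := by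
  have : InnerTouchBall Ω η y (infDist y (frontier Ω)) :=
    ⟨hpos, by rw [dist_comm]; exact hη.2, univ, univ_mem,
      inter_subset_inter_left _ (ball_infDist_frontier_subset hΩ hy)⟩
  exact le_iSup_of_le _ (le_iSup_of_le y (le_iSup_of_le this le_rfl))

/-- A minimizer of a perturbed squared distance over a disc orthogonal to `v` projects onto `η`,
when the boundary is a graph in direction `v`. -/
theorem exists_mem_mproj_of_graph (hne : (frontier Ω).Nonempty)
    {x ξ v : EuclideanSpace ℝ (Fin n)} {s : ℝ} (hs : 0 < s) (hx : ξ ∈ mproj Ω x)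
    (hsing : ∀ y ∈ closedBall x s, ∃ ζ, mproj Ω y = {ζ})
    {U : Set (EuclideanSpace ℝ (Fin n))} (hU : U ∈ 𝓝 ξ)
    (hUs : ∀ y ∈ closedBall x s, mproj Ω y ⊆ U)
    (hinj : ∀ a ∈ frontier Ω ∩ U, ∀ b ∈ frontier Ω ∩ U, ∀ c : ℝ, a - b = c • v → a = b)
    (huniq : ∀ y ∈ closedBall x s, mproj Ω y = {ξ} → ⟪y - x, v⟫ = 0 → y = x) :
    ∀ᶠ η in 𝓝 ξ, η ∈ frontier Ω → ∃ y ∈ closedBall x s, η ∈ mproj Ω y := by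
  have hcd : Continuous fun y => infDist y (frontier Ω) := continuous_infDist_pt _
  have hcl : IsClosed {y : EuclideanSpace ℝ (Fin n) | ⟪y - x, v⟫ = 0} :=
    isClosed_eq (by fun_prop) (by fun_prop)
  obtain ⟨m, hm, hmS⟩ : ∃ m > 0, ∀ y ∈ sphere x s ∩ {y | ⟪y - x, v⟫ = 0},
      m ≤ dist y ξ ^ 2 - infDist y (frontier Ω) ^ 2 := by
    rcases (sphere x s ∩ {y | ⟪y - x, v⟫ = 0}).eq_empty_or_nonempty with h | h
    · exact ⟨1, one_pos, by simp [h]⟩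
    · obtain ⟨z, hz, hmin⟩ := ((isCompact_sphere x s).inter_right hcl).exists_isMinOn h
        (f := fun y => dist y ξ ^ 2 - infDist y (frontier Ω) ^ 2) (by fun_prop)
      refine ⟨dist z ξ ^ 2 - infDist z (frontier Ω) ^ 2, ?_, fun w hw => hmin hw⟩
      have h1 : infDist z (frontier Ω) ≤ dist z ξ := infDist_le_dist_of_mem hx.1
      refine sub_pos.2 (pow_lt_pow_left₀ (lt_of_le_of_ne h1 fun h2 => ?_) infDist_nonneg two_ne_zero)
      have hzs := sphere_subset_closedBall hz.1
      obtain ⟨ζ, hζ⟩ := hsing z hzs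
      have h3 : ξ ∈ mproj Ω z := ⟨hx.1, h2.symm⟩
      rw [hζ, mem_singleton_iff] at h3
      have h4 := huniq z hzs (h3 ▸ hζ) hz.2
      have h5 : dist z x = s := hz.1
      rw [h4, dist_self] at h5
      exact hs.ne h5
  set C := s + dist x ξ with hC
  have hC0 : 0 ≤ C := by positivity
  have hr : 0 < min 1 (m / (2 * (2 * C + 1))) := lt_min one_pos (by positivity)
  filter_upwards [hU, ball_mem_nhds ξ hr] with η hηU hη hηf
  rw [mem_ball] at hη
  have hη1 := (hη.trans_le (min_le_left _ _)).le
  have hη2 := hη.trans_le (min_le_right _ _)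
  rw [lt_div_iff₀ (by positivity)] at hη2
  have hclose : ∀ y ∈ closedBall x s, |dist y η ^ 2 - dist y ξ ^ 2| < m / 2 := by
    intro y hy
    have h1 : |dist y η - dist y ξ| ≤ dist η ξ := by
      rw [dist_comm y η, dist_comm y ξ]; exact abs_dist_sub_le η ξ y
    have h2 : dist y ξ ≤ C := (dist_triangle y x ξ).trans (add_le_add_left (mem_closedBall.1 hy) _)
    have h3 : dist y η ≤ C + 1 := by
      have := dist_triangle_right y η ξ
      linarith
    rw [sq_sub_sq, abs_mul, abs_of_nonneg (by positivity)]
    have h4 : (dist y η + dist y ξ) * |dist y η - dist y ξ| ≤ (2 * C + 1) * dist η ξ :=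
      mul_le_mul (by linarith) h1 (abs_nonneg _) (by positivity)
    linarith
  obtain ⟨y, ⟨hys, hyv⟩, hmin⟩ := ((isCompact_closedBall x s).inter_right hcl).exists_isMinOn
    ⟨x, mem_closedBall_self hs.le, by simp⟩
    (f := fun y => dist y η ^ 2 - infDist y (frontier Ω) ^ 2) (by fun_prop)
  have hmin : ∀ z ∈ closedBall x s ∩ {y | ⟪y - x, v⟫ = 0},
    dist y η ^ 2 - infDist y (frontier Ω) ^ 2 ≤ dist z η ^ 2 - infDist z (frontier Ω) ^ 2 := hmin
  rw [mem_ofPred_eq] at hyv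
  have hlt : dist y x < s := by
    refine lt_of_le_of_ne hys fun heq => ?_
    have h1 := hmS y ⟨heq, hyv⟩
    have h2 := hmin x ⟨mem_closedBall_self hs.le, by simp⟩
    have h3 := abs_lt.1 (hclose y hys)
    have h4 := abs_lt.1 (hclose x (mem_closedBall_self hs.le))
    rw [← hx.2] at h2
    linarith [h3.1, h4.2]
  obtain ⟨ζ, hζ⟩ := hsing y hys
  have hζm : ζ ∈ mproj Ω y := by simp [hζ]
  have hopt : ∀ w, ⟪w, v⟫ = 0 → 0 ≤ ⟪w, ζ - η⟫ := fun w hw => by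
    refine inner_nonneg_of_eventually_le hne hζ ?_
    have hlim : Tendsto (fun t : ℝ => y + t • w) (𝓝[>] 0) (𝓝 y) := by
      have : Continuous fun t : ℝ => y + t • w := by fun_prop
      simpa using (this.tendsto 0).mono_left (nhdsWithin_le_nhds (s := Ioi 0))
    filter_upwards [hlim (isOpen_ball.mem_nhds (mem_ball.2 hlt))] with t ht
    refine hmin _ ⟨ball_subset_closedBall ht, ?_⟩
    rw [mem_ofPred_eq, show y + t • w - x = (y - x) + t • w by abel, inner_add_left,
      inner_smul_left, hyv, hw]
    simp
  refine ⟨y, hys, ?_⟩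
  suffices h : ∃ c : ℝ, ζ - η = c • v by
    obtain ⟨c, hc⟩ := h
    exact hinj ζ ⟨hζm.1, hUs y hys hζm⟩ η ⟨hηf, hηU⟩ c hc ▸ hζm
  refine ⟨⟪ζ - η, v⟫ / ‖v‖ ^ 2, ?_⟩
  set c := ⟪ζ - η, v⟫ / ‖v‖ ^ 2 with hc
  have horth : ⟪ζ - η - c • v, v⟫ = 0 := by
    rw [inner_sub_left, real_inner_smul_left, real_inner_self_eq_norm_sq]
    rcases eq_or_ne v 0 with rfl | hv
    · simp
    · rw [hc, div_mul_cancel₀ _ (by simpa using hv), sub_self]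
  have h1 := hopt (-(ζ - η - c • v)) (by rw [inner_neg_left, horth, neg_zero])
  have h2 : ⟪ζ - η - c • v, ζ - η⟫ = ‖ζ - η - c • v‖ ^ 2 := by
    rw [← real_inner_self_eq_norm_sq, inner_sub_right (ζ - η - c • v) (ζ - η) (c • v),
      real_inner_smul_right, horth, mul_zero, sub_zero]
  rw [inner_neg_left, h2] at h1
  have h3 : ‖ζ - η - c • v‖ = 0 := by
    have := sq_nonneg ‖ζ - η - c • v‖
    exact pow_eq_zero_iff two_ne_zero |>.1 (by linarith)
  exact sub_eq_zero.1 (norm_eq_zero.1 h3)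

theorem eq_of_sub_eq_smul_of_graph {Γ U D : Set (EuclideanSpace ℝ (Fin n))}
    {v : EuclideanSpace ℝ (Fin n)} {g : EuclideanSpace ℝ (Fin n) → ℝ}
    (hD : ∀ z ∈ D, ⟪z, v⟫ = 0) (hΓ : Γ ∩ U = (fun z => z + g z • v) '' D) :
    ∀ a ∈ Γ ∩ U, ∀ b ∈ Γ ∩ U, ∀ c : ℝ, a - b = c • v → a = b := by
  rw [hΓ]
  rintro _ ⟨z, hz, rfl⟩ _ ⟨z', hz', rfl⟩ c hc
  have h1 : z - z' = (c - g z + g z') • v := by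
    simp only at hc
    rw [add_smul, sub_smul, ← hc]
    abel
  have h2 : ⟪z - z', z - z'⟫ = 0 := by
    nth_rewrite 2 [h1]
    rw [real_inner_smul_right, inner_sub_left, hD z hz, hD z' hz']
    simp
  rw [sub_eq_zero.1 (inner_self_eq_zero.1 h2)]

end Projection

/-- **Proposition 3.7.** If `x ∈ Ω \ Σ̄`, `π(x) = {ξ}` and `ξ` has non-spreading inner
perpendicular, then there are `δ > 0` and `r_δ > 0` with `d(x) + δ ≤ ρ(η)` for every
`η ∈ B_{r_δ}(ξ) ∩ ∂Ω`; in particular `d(x) < ρ*(ξ)`. -/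
theorem rho_lower_bound_of_nonSpreading (n : ℕ) (hn : 2 ≤ n)
    (Ω : Set (EuclideanSpace ℝ (Fin n))) (hΩ : IsOpen Ω) (hne : (frontier Ω).Nonempty)
    (x ξ : EuclideanSpace ℝ (Fin n)) (hx : x ∈ Ω \ cutLocus Ω)
    (hξ : mproj Ω x = {ξ}) (hns : NonSpreadingPerp Ω ξ) :
    (∃ δ > (0:ℝ), ∃ rδ > (0:ℝ), ∀ η ∈ Metric.ball ξ rδ ∩ frontier Ω,
        ENNReal.ofReal (Metric.infDist x (frontier Ω) + δ) ≤ rho Ω η) ∧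
      ENNReal.ofReal (Metric.infDist x (frontier Ω)) < rhoStar Ω ξ := by
  obtain ⟨hxΩ, hxc⟩ := hx
  have hxs : x ∉ closure (skel Ω) := fun h => hxc ⟨hxΩ, h⟩
  have hposΩ : ∀ y ∈ Ω, 0 < infDist y (frontier Ω) := fun y hy =>
    (isClosed_frontier.notMem_iff_infDist_pos hne).1 fun h => by
      rw [hΩ.frontier_eq] at h
      exact h.2 hy
  obtain ⟨R, hR, hball⟩ := Metric.isOpen_iff.1 (hΩ.inter isClosed_closure.isOpen_compl) x ⟨hxΩ, hxs⟩
  have hsing : ∀ y ∈ ball x R, ∃ ζ, mproj Ω y = {ζ} := fun y hy => by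
    by_contra h
    exact (hball hy).2 (subset_closure ⟨(hball hy).1, h⟩)
  have hsub : closedBall x (R / 2) ⊆ ball x R := closedBall_subset_ball (by linarith)
  obtain ⟨x', hx', hdx'⟩ := exists_infDist_eq_add hne (half_pos hR).le
    (fun y hy => hposΩ y (hball (hsub hy)).1) fun y hy => hsing y (hsub hy)
  have hξm : ξ ∈ mproj Ω x := by simp [hξ]
  have hξ' : ξ ∈ mproj Ω x' := by
    refine ⟨hξm.1, le_antisymm ?_ (infDist_le_dist_of_mem hξm.1)⟩
    rw [hdx', ← hξm.2, add_comm]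
    exact (dist_triangle x' x ξ).trans (by gcongr; exact hx')
  have hξs : mproj Ω x' = {ξ} := by
    obtain ⟨ζ, hζ⟩ := hsing x' (hsub hx')
    rw [hζ, mem_singleton_iff] at hξ'
    rw [hζ, hξ']
  obtain ⟨p, v, hv, hline, U, hU, D, g, hD, hΓ⟩ := hns.resolve_left
    (Nonempty.ne_empty ⟨x, hxΩ, hξ⟩)
  obtain ⟨r, hr, hrU⟩ := Metric.eventually_nhds_iff_ball.1 (eventually_mproj_subset hξs hU)
  set s := min (r / 2) (R / 4) with hs
  have hs0 : 0 < s := lt_min (half_pos hr) (by linarith)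
  have hsr : s < r := (min_le_left _ _).trans_lt (half_lt_self hr)
  have hsR : s ≤ R / 4 := min_le_right _ _
  have hsub' : closedBall x' s ⊆ ball x R := fun y hy => by
    rw [mem_closedBall] at hy hx'
    have := dist_triangle y x' x
    rw [mem_ball]
    linarith
  have hev := exists_mem_mproj_of_graph hne (v := v) hs0 hξ' (fun y hy => hsing y (hsub' hy)) hU
    (fun y hy => hrU y (closedBall_subset_ball hsr hy)) (eq_of_sub_eq_smul_of_graph hD hΓ)
    (fun y hy hyξ hyv => by
      obtain ⟨t₁, h1⟩ := hline ⟨(hball (hsub' hy)).1, hyξ⟩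
      obtain ⟨t₂, h2⟩ := hline ⟨(hball (hsub hx')).1, hξs⟩
      have h3 : y - x' = (t₁ - t₂) • v := by rw [h1, h2, sub_smul]; abel
      rw [h3, real_inner_smul_left, mul_eq_zero] at hyv
      rcases hyv with h | h
      · rw [h, zero_smul] at h3
        exact sub_eq_zero.1 h3
      · exact absurd (inner_self_eq_zero.1 h) hv)
  obtain ⟨rδ, hrδ, hmain⟩ := Metric.eventually_nhds_iff_ball.1 hev
  have hbound : ∀ η ∈ ball ξ rδ ∩ frontier Ω,
      ENNReal.ofReal (infDist x (frontier Ω) + R / 4) ≤ rho Ω η := by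
    rintro η ⟨hη, hηf⟩
    obtain ⟨y, hy, hyη⟩ := hmain η hη hηf
    have hyΩ := (hball (hsub' hy)).1
    refine le_trans (ENNReal.ofReal_le_ofReal ?_) (ofReal_infDist_le_rho hΩ hyΩ (hposΩ y hyΩ) hyη)
    have h1 : infDist x' (frontier Ω) ≤ infDist y (frontier Ω) + dist x' y :=
      infDist_le_infDist_add_dist
    rw [mem_closedBall, dist_comm] at hy
    linarith
  refine ⟨⟨R / 4, by positivity, rδ, hrδ, hbound⟩, ?_⟩
  have h1 : ENNReal.ofReal (infDist x (frontier Ω)) <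
      ENNReal.ofReal (infDist x (frontier Ω) + R / 4) :=
    (ENNReal.ofReal_lt_ofReal_iff (by linarith [hposΩ x hxΩ])).2 (by linarith)
  exact h1.trans_le (le_iSup₂_of_le rδ hrδ (le_iInf₂ hbound))
end
end

section
/- Let h: [a,b] → ℝ be continuous and let h̃: [a,b] → ℝ be an arc of an upper semicircle of radius r̃ > (b−a)/2 such that h ≥ h̃ on [a,b] and h(a) = h̃(a), h(b) = h̃(b). Then there exists c ∈ (a,b) such that no upper semicircle of radius strictly larger than r̃ touches h from below at c. -/
open Set Metric Filter
open scoped RealInnerProductSpace ENNReal Topology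

noncomputable section

/-- Derivative of a semicircle at an interior point of its domain. -/
lemma hasDerivAt_semicircle {c₁ c₂ r c : ℝ} (hc : 0 < r ^ 2 - (c - c₁) ^ 2) :
    HasDerivAt (semicircle c₁ c₂ r) (-(c - c₁) / √(r ^ 2 - (c - c₁) ^ 2)) c := by
  have h1 : HasDerivAt (fun t : ℝ => r ^ 2 - (t - c₁) ^ 2) (-(2 * (c - c₁))) c := by
    simpa using (((hasDerivAt_id c).sub_const c₁).pow 2).const_sub (r ^ 2)
  have h2 := (h1.sqrt hc.ne').const_add c₂
  have h3 : -(2 * (c - c₁)) / (2 * √(r ^ 2 - (c - c₁) ^ 2)) =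
      -(c - c₁) / √(r ^ 2 - (c - c₁) ^ 2) := by
    rw [← mul_neg, mul_div_mul_left _ _ two_ne_zero]
  rw [h3] at h2
  exact h2

lemma continuous_semicircle (c₁ c₂ r : ℝ) : Continuous (semicircle c₁ c₂ r) := by
  unfold semicircle
  fun_prop

lemma sq_sub_pos_of_mem_Ioo {c₁ r c : ℝ} (hc : c ∈ Set.Ioo (c₁ - r) (c₁ + r)) :
    0 < r ^ 2 - (c - c₁) ^ 2 := by
  nlinarith [hc.1, hc.2, mul_pos (sub_pos.2 hc.1) (sub_pos.2 hc.2)]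

/-- If two semicircles are tangent at a point, the ratio of their radii being `k > 1`, then the
larger one grows strictly more near that point. -/
lemma sqrt_sub_lt_of_homothetic {u p k x : ℝ} (hp : 0 < p) (hk : 1 < k) (hx : x ≠ 0)
    (hsmall : 0 < p ^ 2 - u * x) (hdom : 0 ≤ u ^ 2 + p ^ 2 - (u + x) ^ 2) :
    √(u ^ 2 + p ^ 2 - (u + x) ^ 2) - p < √((k * u) ^ 2 + (k * p) ^ 2 - (k * u + x) ^ 2) - k * p := by
  set w := √(u ^ 2 + p ^ 2 - (u + x) ^ 2) with hw
  have hw2 : w ^ 2 = u ^ 2 + p ^ 2 - (u + x) ^ 2 := Real.sq_sqrt hdom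
  have hpw : p * w < p ^ 2 - u * x := by
    refine lt_of_pow_lt_pow_left₀ 2 hsmall.le ?_
    have : 0 < x ^ 2 * (u ^ 2 + p ^ 2) := by positivity
    rw [mul_pow, hw2]
    linarith
  have : w + (k - 1) * p < √((k * u) ^ 2 + (k * p) ^ 2 - (k * u + x) ^ 2) := by
    refine Real.lt_sqrt_of_sq_lt ?_
    have := mul_lt_mul_of_pos_left hpw (sub_pos.2 hk)
    linear_combination 2 * this + hw2
  linarith

/-- A semicircle cannot lie locally below a vertical translate of a semicircle of strictly smaller
radius while meeting it at an interior point. -/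
lemma not_eventually_semicircle_le {c₁ c₂ r₀ d₁ d₂ r c : ℝ} (hr₀ : 0 < r₀) (hr : r₀ < r)
    (hc : c ∈ Set.Ioo (c₁ - r₀) (c₁ + r₀)) (hd : c ∈ Set.Ioo (d₁ - r) (d₁ + r)) :
    ¬ ∀ᶠ t in 𝓝 c, semicircle d₁ d₂ r t - semicircle d₁ d₂ r c ≤
      semicircle c₁ c₂ r₀ t - semicircle c₁ c₂ r₀ c := by
  intro hle
  have hc' := sq_sub_pos_of_mem_Ioo hc
  have hd' := sq_sub_pos_of_mem_Ioo hd
  have hmin : IsLocalMin (fun t => semicircle c₁ c₂ r₀ t - semicircle d₁ d₂ r t) c := by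
    filter_upwards [hle] with t ht
    linarith
  have hder := hmin.hasDerivAt_eq_zero
    ((hasDerivAt_semicircle (c₂ := c₂) hc').sub (hasDerivAt_semicircle (c₂ := d₂) hd'))
  have hp := Real.sqrt_pos.2 hc'
  have hq := Real.sqrt_pos.2 hd'
  have hp2 := Real.sq_sqrt hc'.le
  have hq2 := Real.sq_sqrt hd'.le
  set p := √(r₀ ^ 2 - (c - c₁) ^ 2) with hpdef
  set q := √(r ^ 2 - (c - d₁) ^ 2) with hqdef
  set u := c - c₁ with hu
  set v := c - d₁ with hv
  have hslope : v * p = u * q := by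
    field_simp at hder
    linarith
  obtain ⟨k, hqk⟩ : ∃ k, q = k * p := ⟨q / p, by field_simp⟩
  have hvk : v = k * u := by
    rw [hqk] at hslope
    exact mul_right_cancel₀ hp.ne' (by linarith)
  have hkpos : 0 < k := pos_of_mul_pos_left (hqk ▸ hq) hp.le
  have hrk : r ^ 2 = (k * r₀) ^ 2 := by
    rw [hqk, hvk] at hq2
    linear_combination k ^ 2 * hp2 - hq2
  have hk : 1 < k := by
    have : r = k * r₀ := (sq_eq_sq₀ (hr₀.trans hr).le (by positivity)).1 hrk
    by_contra! hcon
    nlinarith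
  have hsmall : ∀ᶠ t in 𝓝 c, 0 < p ^ 2 - u * (t - c) := by
    have hcont : Continuous fun t => p ^ 2 - u * (t - c) := by fun_prop
    exact hcont.continuousAt.eventually (lt_mem_nhds (by simpa using pow_pos hp 2))
  have hev := ((hle.and hsmall).and (Ioo_mem_nhds hc.1 hc.2)).filter_mono
    (nhdsWithin_le_nhds (s := {c}ᶜ))
  obtain ⟨t, ⟨⟨ht, hts⟩, htd⟩, htc⟩ := (hev.and self_mem_nhdsWithin).exists
  have h1 : u ^ 2 + p ^ 2 - (u + (t - c)) ^ 2 = r₀ ^ 2 - (t - c₁) ^ 2 := by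
    rw [hp2, hu]; ring
  have h2 : (k * u) ^ 2 + (k * p) ^ 2 - (k * u + (t - c)) ^ 2 = r ^ 2 - (t - d₁) ^ 2 := by
    rw [← hvk, ← hqk, hq2, hv]; ring
  have key := sqrt_sub_lt_of_homothetic hp hk (sub_ne_zero.2 htc) hts
    (h1 ▸ (sq_sub_pos_of_mem_Ioo htd).le)
  rw [h1, h2, ← hqk, hpdef, hqdef] at key
  unfold semicircle at ht
  linarith

/-- A continuous nonnegative function on `[a, b]` vanishing at the endpoints attains its maximum
at an interior point. -/
lemma exists_mem_Ioo_isMaxOn {a b : ℝ} (hab : a < b) {f : ℝ → ℝ}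
    (hf : ContinuousOn f (Set.Icc a b)) (hf0 : ∀ t ∈ Set.Icc a b, 0 ≤ f t)
    (ha : f a = 0) (hb : f b = 0) : ∃ c ∈ Set.Ioo a b, IsMaxOn f (Set.Icc a b) c := by
  obtain ⟨m, hm, hmax⟩ := isCompact_Icc.exists_isMaxOn (nonempty_Icc.2 hab.le) hf
  by_cases hmI : m ∈ Set.Ioo a b
  · exact ⟨m, hmI, hmax⟩
  have hm0 : f m = 0 := by
    rcases eq_endpoints_or_mem_Ioo_of_mem_Icc hm with rfl | rfl | h
    exacts [ha, hb, absurd h hmI]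
  obtain ⟨c, hc⟩ := nonempty_Ioo.2 hab
  refine ⟨c, hc, fun t ht => ?_⟩
  exact (hmax ht).trans (hm0.le.trans (hf0 c (Ioo_subset_Icc_self hc)))

/-- **Lemma 3.3.** If `h` is continuous on `[a,b]`, lies above an arc of an upper
semicircle of radius `r₀ > (b-a)/2` and agrees with it at the endpoints, then there is
`c ∈ (a,b)` at which no upper semicircle of radius `> r₀` touches `h` from below. -/
theorem no_larger_semicircle_touches (a b r₀ c₁ c₂ : ℝ) (hab : a < b)
    (h : ℝ → ℝ) (hcont : ContinuousOn h (Set.Icc a b))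
    (hr : (b - a) / 2 < r₀)
    (hsub : Set.Icc a b ⊆ Set.Icc (c₁ - r₀) (c₁ + r₀))
    (hge : ∀ t ∈ Set.Icc a b, semicircle c₁ c₂ r₀ t ≤ h t)
    (hA : h a = semicircle c₁ c₂ r₀ a) (hB : h b = semicircle c₁ c₂ r₀ b) :
    ∃ c ∈ Set.Ioo a b, ∀ d₁ d₂ r : ℝ, r₀ < r → c ∈ Set.Ioo (d₁ - r) (d₁ + r) →
      ¬ (semicircle d₁ d₂ r c = h c ∧
          ∀ᶠ t in nhdsWithin c (Set.Icc a b), semicircle d₁ d₂ r t ≤ h t) := by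
  have hr₀ : 0 < r₀ := by linarith
  obtain ⟨c, hc, hmax⟩ := exists_mem_Ioo_isMaxOn hab
    (hcont.sub (continuous_semicircle c₁ c₂ r₀).continuousOn)
    (fun t ht => sub_nonneg.2 (hge t ht)) (sub_eq_zero.2 hA) (sub_eq_zero.2 hB)
  have hc₁ : c ∈ Set.Ioo (c₁ - r₀) (c₁ + r₀) :=
    ⟨(hsub (left_mem_Icc.2 hab.le)).1.trans_lt hc.1,
      hc.2.trans_le (hsub (right_mem_Icc.2 hab.le)).2⟩
  refine ⟨c, hc, fun d₁ d₂ r hrr hd ⟨heq, hev⟩ => ?_⟩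
  refine not_eventually_semicircle_le (c₂ := c₂) (d₂ := d₂) hr₀ hrr hc₁ hd ?_
  have hI : Set.Icc a b ∈ 𝓝 c := Icc_mem_nhds hc.1 hc.2
  rw [nhdsWithin_eq_nhds.2 hI] at hev
  filter_upwards [hev, hI] with t ht htI
  have : h t - semicircle c₁ c₂ r₀ t ≤ h c - semicircle c₁ c₂ r₀ c := hmax htI
  linarith
end
end

section
/- Let m ≥ 1, y ∈ ℝᵐ, U an open neighborhood of y in ℝᵐ, and f: U → ℝ a C¹ function. Suppose there exists an upper semi-sphere of radius r₀ (i.e., a function of the form z ↦ c_{m+1} + √(r₀² − |z − c'|²) for some center (c', c_{m+1}) ∈ ℝᵐ × ℝ) touching f from below at y. Then for any closed segment I ⊂ U with y ∈ I, there exists an upper semicircle of radius r ≥ r₀/√(1 + |∇f(y)|²) touching f|_I from below at y. -/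
open Set Metric Filter
open scoped RealInnerProductSpace ENNReal Topology

noncomputable section

/-- The gradient of the upper semi-sphere of radius `r` centered at `(c, b)`. -/
lemma hasGradientAt_semisphere {E : Type*} [NormedAddCommGroup E] [InnerProductSpace ℝ E]
    [CompleteSpace E] {r : ℝ} {c y : E} (b : ℝ) (hy : ‖y - c‖ ^ 2 < r ^ 2) :
    HasGradientAt (fun z => b + Real.sqrt (r ^ 2 - ‖z - c‖ ^ 2))
      (-(Real.sqrt (r ^ 2 - ‖y - c‖ ^ 2))⁻¹ • (y - c)) y := by
  have h1 : HasFDerivAt (fun z : E => ‖z - c‖ ^ 2) (2 • innerSL ℝ (y - c)) y := by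
    simpa using ((hasFDerivAt_id y).sub_const c).norm_sq
  have h2 := ((h1.const_sub (r ^ 2)).sqrt (sub_pos.2 hy).ne').const_add b
  rw [hasGradientAt_iff_hasFDerivAt]
  refine h2.congr_fderiv ?_
  ext v
  simp
  ring

/-- Two functions that touch at a point have the same gradient there. -/
lemma HasGradientAt.eq_of_eventually_le {E : Type*} [NormedAddCommGroup E]
    [InnerProductSpace ℝ E] [CompleteSpace E] {f g : E → ℝ} {f' g' y : E}
    (hf : HasGradientAt f f' y) (hg : HasGradientAt g g' y) (heq : g y = f y)
    (hle : ∀ᶠ z in 𝓝 y, g z ≤ f z) : f' = g' := by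
  have hmin : IsLocalMin (fun z => f z - g z) y := by
    filter_upwards [hle] with z hz
    simp only [heq, sub_self]
    linarith
  have h0 := hmin.hasFDerivAt_eq_zero (hf.hasFDerivAt.sub hg.hasFDerivAt)
  exact (InnerProductSpace.toDual ℝ E).injective (sub_eq_zero.1 h0)

/-- A point of a segment, in the isometric parametrization of the segment. -/
lemma exists_add_smul_eq_of_mem_segment {E : Type*} [NormedAddCommGroup E] [NormedSpace ℝ E]
    {p q y : E} (hpq : p ≠ q) (hy : y ∈ segment ℝ p q) :
    ∃ t ∈ Set.Icc 0 ‖q - p‖, p + t • (‖q - p‖⁻¹ • (q - p)) = y := by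
  have hL : 0 < ‖q - p‖ := norm_pos_iff.2 (sub_ne_zero.2 hpq.symm)
  rw [segment_eq_image'] at hy
  obtain ⟨θ, ⟨h0, h1⟩, rfl⟩ := hy
  refine ⟨θ * ‖q - p‖, ⟨by positivity, mul_le_of_le_one_left hL.le h1⟩, ?_⟩
  rw [smul_smul, mul_assoc, mul_inv_cancel₀ hL.ne', mul_one]

/-- The restriction of a semi-sphere to a line is a semicircle. -/
lemma sub_norm_sq_add_smul {E : Type*} [NormedAddCommGroup E] [InnerProductSpace ℝ E]
    {e : E} (he : ‖e‖ = 1) (w : E) (r s : ℝ) :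
    r ^ 2 - ‖w + s • e‖ ^ 2 = (r ^ 2 - ‖w‖ ^ 2 + ⟪w, e⟫ ^ 2) - (s + ⟪w, e⟫) ^ 2 := by
  rw [norm_add_sq_real, inner_smul_right, norm_smul, he, mul_one, Real.norm_eq_abs, sq_abs]
  ring

/-- **Lemma 3.4.** If an upper semi-sphere of radius `r₀` touches a `C¹` function `f`
from below at `y`, then on any closed segment `I ⊆ U` through `y` (isometrically
parametrized), some upper semicircle of radius `r ≥ r₀ / √(1 + |∇f(y)|²)` touches
`f|_I` from below at `y`. -/
theorem semicircle_touch_of_semisphere_touch (m : ℕ) (hm : 1 ≤ m)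
    (y : EuclideanSpace ℝ (Fin m)) (U : Set (EuclideanSpace ℝ (Fin m)))
    (hU : IsOpen U) (hyU : y ∈ U)
    (f : EuclideanSpace ℝ (Fin m) → ℝ) (hf : ContDiffOn ℝ 1 f U)
    (r₀ : ℝ) (hr₀ : 0 < r₀) (c' : EuclideanSpace ℝ (Fin m)) (cm : ℝ)
    (hin : dist y c' < r₀)
    (htouch₀ : cm + Real.sqrt (r₀ ^ 2 - ‖y - c'‖ ^ 2) = f y)
    (htouch : ∀ᶠ z in nhdsWithin y U, cm + Real.sqrt (r₀ ^ 2 - ‖z - c'‖ ^ 2) ≤ f z)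
    (p q : EuclideanSpace ℝ (Fin m)) (hpq : p ≠ q)
    (hIU : segment ℝ p q ⊆ U) (hyI : y ∈ segment ℝ p q) :
    ∃ r : ℝ, r₀ / Real.sqrt (1 + ‖gradient f y‖ ^ 2) ≤ r ∧
      ∃ c₁ c₂ ty : ℝ, ty ∈ Set.Icc 0 ‖q - p‖ ∧
        p + ty • (‖q - p‖⁻¹ • (q - p)) = y ∧
        ty ∈ Set.Ioo (c₁ - r) (c₁ + r) ∧
        semicircle c₁ c₂ r ty = f y ∧
        ∀ᶠ t in nhdsWithin ty (Set.Icc 0 ‖q - p‖),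
          semicircle c₁ c₂ r t ≤ f (p + t • (‖q - p‖⁻¹ • (q - p))) := by
  obtain ⟨ty, hty, hy⟩ := exists_add_smul_eq_of_mem_segment hpq hyI
  have hL : 0 < ‖q - p‖ := norm_pos_iff.2 (sub_ne_zero.2 hpq.symm)
  set e : EuclideanSpace ℝ (Fin m) := ‖q - p‖⁻¹ • (q - p) with he_def
  have he : ‖e‖ = 1 := by
    rw [he_def, norm_smul, norm_inv, norm_norm, inv_mul_cancel₀ hL.ne']
  set w := y - c' with hw
  have hwr : ‖w‖ ^ 2 < r₀ ^ 2 := by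
    rw [dist_eq_norm] at hin
    exact pow_lt_pow_left₀ hin (norm_nonneg _) two_ne_zero
  have hpos : 0 < r₀ ^ 2 - ‖w‖ ^ 2 := sub_pos.2 hwr
  have hnhds : ∀ᶠ z in 𝓝 y, cm + Real.sqrt (r₀ ^ 2 - ‖z - c'‖ ^ 2) ≤ f z := by
    rwa [hU.nhdsWithin_eq hyU] at htouch
  have hgrad : gradient f y = -(Real.sqrt (r₀ ^ 2 - ‖w‖ ^ 2))⁻¹ • w :=
    ((hf.contDiffAt (hU.mem_nhds hyU)).differentiableAt one_ne_zero).hasGradientAt.eq_of_eventually_le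
      (hasGradientAt_semisphere cm hwr) htouch₀ hnhds
  have hnorm : 1 + ‖gradient f y‖ ^ 2 = r₀ ^ 2 / (r₀ ^ 2 - ‖w‖ ^ 2) := by
    rw [hgrad, norm_smul, norm_neg, norm_inv, mul_pow, inv_pow, Real.norm_eq_abs, sq_abs,
      Real.sq_sqrt hpos.le]
    field_simp
    ring
  have hsq : Real.sqrt (r₀ ^ 2 - ‖w‖ ^ 2 + ⟪w, e⟫ ^ 2) ^ 2 = r₀ ^ 2 - ‖w‖ ^ 2 + ⟪w, e⟫ ^ 2 :=
    Real.sq_sqrt (by positivity)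
  have hrestrict : ∀ t, semicircle (ty - ⟪w, e⟫) cm (Real.sqrt (r₀ ^ 2 - ‖w‖ ^ 2 + ⟪w, e⟫ ^ 2)) t
      = cm + Real.sqrt (r₀ ^ 2 - ‖p + t • e - c'‖ ^ 2) := by
    intro t
    have hz : p + t • e - c' = w + (t - ty) • e := by
      rw [hw, ← hy, sub_smul]
      abel
    rw [semicircle, hsq, hz, sub_norm_sq_add_smul he]
    ring_nf
  refine ⟨Real.sqrt (r₀ ^ 2 - ‖w‖ ^ 2 + ⟪w, e⟫ ^ 2), ?_, ty - ⟪w, e⟫, cm, ty, hty, hy, ?_, ?_, ?_⟩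
  · rw [hnorm, Real.sqrt_div (sq_nonneg _), Real.sqrt_sq hr₀.le, div_div_cancel₀ hr₀.ne']
    exact Real.sqrt_le_sqrt (le_add_of_nonneg_right (sq_nonneg _))
  · have habs : |⟪w, e⟫| < Real.sqrt (r₀ ^ 2 - ‖w‖ ^ 2 + ⟪w, e⟫ ^ 2) :=
      Real.lt_sqrt_of_sq_lt (by rw [sq_abs]; linarith)
    obtain ⟨h1, h2⟩ := abs_lt.1 habs
    constructor <;> linarith
  · rw [hrestrict, hy, htouch₀]
  · have hcont : Tendsto (fun t : ℝ => p + t • e) (𝓝 ty) (𝓝 y) := by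
      have hc : Continuous fun t : ℝ => p + t • e := by fun_prop
      simpa only [hy] using hc.tendsto ty
    filter_upwards [nhdsWithin_le_nhds (hcont.eventually hnhds)] with t ht
    rw [hrestrict]
    exact ht
end
end

section
/- For m ≥ 1, there does not exist a continuous map f: B̄ᵐ → S^{m−1} from the closed m-dimensional unit ball to its boundary sphere such that the restriction f|_{S^{m−1}} is homotopic to the identity map of S^{m−1}. -/
open Set Metric Filter
open scoped RealInnerProductSpace ENNReal Topology

noncomputable section

section NoRetraction

variable {E : Type*} [NormedAddCommGroup E]

/-- A perturbation of the identity by a strict contraction is bijective. -/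
lemma bijective_add_of_contracting [CompleteSpace E] {K : NNReal} {w : E → E}
    (hw : LipschitzWith K w) (hK : K < 1) : Function.Bijective fun x => x + w x := by
  constructor
  · intro x y hxy
    have h1 : x - y = w y - w x := by
      have : x + w x = y + w y := hxy
      rw [sub_eq_sub_iff_add_eq_add, this, add_comm]
    have h2 : ‖x - y‖ ≤ K * ‖x - y‖ := by
      calc ‖x - y‖ = dist (w x) (w y) := by rw [h1, dist_comm, dist_eq_norm]
        _ ≤ K * dist x y := hw.dist_le_mul x y
        _ = K * ‖x - y‖ := by rw [dist_eq_norm]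
    have h3 : (K : ℝ) < 1 := by exact_mod_cast hK
    have h4 : ‖x - y‖ = 0 := by nlinarith [norm_nonneg (x - y)]
    exact sub_eq_zero.mp (norm_eq_zero.mp h4)
  · intro y
    have hc : ContractingWith K fun x => y - w x :=
      ⟨hK, LipschitzWith.of_dist_le_mul fun a b => by
        rw [dist_sub_left]; exact hw.dist_le_mul a b⟩
    have hfix : y - w (hc.fixedPoint _) = hc.fixedPoint _ := hc.fixedPoint_isFixedPt
    exact ⟨hc.fixedPoint _, by simp only; nth_rewrite 1 [← hfix]; simp⟩

/-- A bijection that fixes every point outside `s` maps `s` onto itself. -/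
lemma image_eq_of_bijective_of_fixed {α : Type*} {f : α → α} {s : Set α}
    (hf : Function.Bijective f) (hs : ∀ x ∉ s, f x = x) : f '' s = s := by
  ext y
  constructor
  · rintro ⟨x, hx, rfl⟩
    by_contra hy
    exact hy ((hf.1 (hs _ hy)).symm ▸ hx)
  · intro hy
    obtain ⟨x, rfl⟩ := hf.2 y
    by_contra hx
    have hxs : x ∉ s := fun h => hx ⟨x, h, rfl⟩
    exact hxs (hs x hxs ▸ hy)

/-- Extending by zero a Lipschitz map on a ball that vanishes on the bounding sphere
preserves the Lipschitz constant. -/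
lemma lipschitzWith_indicator_closedBall [NormedSpace ℝ E] {K : NNReal} {v : E → E} {R : ℝ}
    (hv : LipschitzOnWith K v (closedBall 0 R)) (h0 : ∀ x ∈ sphere (0 : E) R, v x = 0) :
    LipschitzWith K ((closedBall (0 : E) R).indicator v) := by
  have key : ∀ x ∈ closedBall (0 : E) R, ∀ y ∉ closedBall (0 : E) R,
      ‖v x‖ ≤ K * dist x y := by
    intro x hx y hy
    rw [mem_closedBall_zero_iff] at hx hy
    have hc : ContinuousOn (fun t : ℝ => ‖AffineMap.lineMap x y t‖) (Icc 0 1) :=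
      (AffineMap.lineMap_continuous.norm).continuousOn
    obtain ⟨t, ht, htR⟩ := intermediate_value_Icc zero_le_one hc
      (show R ∈ Icc _ _ by simpa using ⟨hx, (not_le.mp hy).le⟩)
    set z : E := AffineMap.lineMap x y t
    have hz : z ∈ sphere (0 : E) R := mem_sphere_zero_iff_norm.mpr htR
    calc ‖v x‖ = dist (v x) (v z) := by rw [h0 z hz, dist_zero_right]
      _ ≤ K * dist x z :=
        hv.dist_le_mul x (mem_closedBall_zero_iff.mpr hx) z (sphere_subset_closedBall hz)
      _ = K * (t * dist x y) := by
        rw [dist_left_lineMap, Real.norm_of_nonneg ht.1]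
      _ ≤ K * dist x y := by
        gcongr
        exact mul_le_of_le_one_left dist_nonneg ht.2
  refine LipschitzWith.of_dist_le_mul fun x y => ?_
  by_cases hx : x ∈ closedBall (0 : E) R <;> by_cases hy : y ∈ closedBall (0 : E) R
  · simpa [indicator_of_mem hx, indicator_of_mem hy] using hv.dist_le_mul x hx y hy
  · simpa [indicator_of_mem hx, indicator_of_notMem hy] using key x hx y hy
  · simpa [indicator_of_notMem hx, indicator_of_mem hy, dist_comm] using key y hy x hx
  · rw [indicator_of_notMem hx, indicator_of_notMem hy, dist_self]
    positivity

/-- The determinant of `1 + t • A` is a polynomial in `t` of degree at most the dimension. -/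
lemma exists_polynomial_eval_eq_det [NormedSpace ℝ E] [FiniteDimensional ℝ E] (A : E →L[ℝ] E) :
    ∃ p : Polynomial ℝ, p.natDegree ≤ Module.finrank ℝ E ∧
      ∀ t : ℝ, p.eval t = (1 + t • A).det := by
  let b := Module.finBasis ℝ E
  let M := LinearMap.toMatrix b b (A : E →ₗ[ℝ] E)
  refine ⟨Matrix.det ((Polynomial.X : Polynomial ℝ) • M.map Polynomial.C +
    (1 : Matrix _ _ ℝ).map Polynomial.C), ?_, fun t => ?_⟩
  · simpa using Polynomial.natDegree_det_X_add_C_le M 1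
  · have hdet : (1 + t • A).det = (t • M + 1).det := by
      rw [ContinuousLinearMap.det, ← LinearMap.det_toMatrix b]
      congr 1
      simp only [ContinuousLinearMap.toLinearMap_add, ContinuousLinearMap.toLinearMap_smul,
        map_add, map_smul, M, add_comm (t • _)]
      congr 1
      exact LinearMap.toMatrix_one b
    rw [hdet, ← Polynomial.coe_evalRingHom, RingHom.map_det]
    congr 1
    ext i j
    by_cases hij : i = j <;> simp [hij, mul_comm t]

/-- Values at `1` of polynomials of bounded degree are given by a universal affine combination of
their values at nodes in any prescribed interval `(0, δ)`. -/
lemma exists_nodes_weights (n : ℕ) {δ : ℝ} (hδ : 0 < δ) :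
    ∃ τ ω : Fin (n + 1) → ℝ, (∀ i, τ i ∈ Ioo 0 δ) ∧ ∑ i, ω i = 1 ∧
      ∀ p : Polynomial ℝ, p.natDegree ≤ n → p.eval 1 = ∑ i, ω i * p.eval (τ i) := by
  let τ : Fin (n + 1) → ℝ := fun i => δ * ((i + 1 : ℝ) / (n + 2))
  have hτ : Function.Injective τ := by
    intro i j hij
    have h := mul_left_cancel₀ hδ.ne' hij
    rw [div_left_inj' (by positivity)] at h
    exact Fin.ext (by exact_mod_cast add_right_cancel h)
  have hp : ∀ p : Polynomial ℝ, p.natDegree ≤ n →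
      p.eval 1 = ∑ i, (Lagrange.basis Finset.univ τ i).eval 1 * p.eval (τ i) := by
    intro p hp
    have hdeg : p.degree < (Finset.univ : Finset (Fin (n + 1))).card := by
      rw [Finset.card_univ, Fintype.card_fin]
      exact lt_of_le_of_lt Polynomial.degree_le_natDegree (by exact_mod_cast Nat.lt_succ_of_le hp)
    conv_lhs => rw [Lagrange.eq_interpolate hτ.injOn hdeg]
    simp [Lagrange.interpolate_apply, Polynomial.eval_finsetSum, mul_comm]
  refine ⟨τ, fun i => (Lagrange.basis Finset.univ τ i).eval 1, fun i => ⟨by positivity, ?_⟩,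
    ?_, hp⟩
  · refine mul_lt_of_lt_one_right hδ ((div_lt_one (by positivity)).mpr ?_)
    have : (i : ℝ) < n + 1 := by exact_mod_cast i.2
    linarith
  · simpa using (hp 1 (by simp)).symm

/-- The derivative of a differentiable map into a sphere of positive radius is singular. -/
lemma det_fderiv_eq_zero_of_norm_eq [InnerProductSpace ℝ E] [FiniteDimensional ℝ E] {g : E → E}
    {R : ℝ} (hR : 0 < R) (hg : ∀ x, ‖g x‖ = R) {x : E} (hd : DifferentiableAt ℝ g x) :
    (fderiv ℝ g x).det = 0 := by
  by_contra hdet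
  have hconst : (fun y => ⟪g y, g y⟫) = fun _ => R ^ 2 := by
    funext y; rw [real_inner_self_eq_norm_sq, hg]
  have h1 := hd.hasFDerivAt.inner ℝ hd.hasFDerivAt
  rw [hconst] at h1
  have h2 := h1.unique (hasFDerivAt_const (R ^ 2) x)
  obtain ⟨h, hh⟩ := ((fderiv ℝ g x).toContinuousLinearEquivOfDetNeZero hdet).surjective (g x)
  have hh' : fderiv ℝ g x h = g x := hh
  have h3 := DFunLike.congr_fun h2 h
  simp [hh', hg] at h3
  exact hR.ne' h3

/-- For small `t`, the map `x ↦ x + t (g x - x)` preserves the volume of the ball when `g` fixes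
the bounding sphere. -/
lemma exists_forall_integral_det_eq [NormedSpace ℝ E] [FiniteDimensional ℝ E] [MeasurableSpace E]
    [BorelSpace E] (μ : MeasureTheory.Measure E) [μ.IsAddHaarMeasure] {g : E → E} {R : ℝ}
    (hg : ContDiff ℝ 1 g) (hfix : ∀ x ∈ sphere (0 : E) R, g x = x) :
    ∃ δ > 0, ∀ t ∈ Ioo (0 : ℝ) δ,
      ∫ x in closedBall (0 : E) R, (1 + t • (fderiv ℝ g x - 1)).det ∂μ
        = μ.real (closedBall (0 : E) R) := by
  have : CompleteSpace E := FiniteDimensional.complete ℝ E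
  set B := closedBall (0 : E) R
  have hcont : Continuous fun x => fderiv ℝ g x - 1 :=
    (hg.continuous_fderiv one_ne_zero).sub continuous_const
  obtain ⟨C, hC⟩ := (isCompact_closedBall (0 : E) R).exists_bound_of_continuousOn hcont.continuousOn
  let K : NNReal := Real.toNNReal C + 1
  have hK : ∀ x ∈ B, ‖fderiv ℝ g x - 1‖ ≤ K := fun x hx =>
    (hC x hx).trans ((Real.le_coe_toNNReal C).trans (by simp [K]))
  have hKpos : (0 : ℝ) < K := by positivity
  have hder : ∀ x, HasFDerivAt (fun x => g x - x) (fderiv ℝ g x - 1) x := fun x =>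
    ((hg.differentiable one_ne_zero x).hasFDerivAt).sub (hasFDerivAt_id x)
  have hlip : LipschitzOnWith K (fun x => g x - x) B :=
    (convex_closedBall (0 : E) R).lipschitzOnWith_of_nnnorm_hasFDerivWithin_le
      (fun x _ => (hder x).hasFDerivWithinAt) hK
  have hw := lipschitzWith_indicator_closedBall hlip
    (fun x hx => by simp [hfix x hx])
  set w := B.indicator fun x => g x - x
  have hdet1 : ∀ᶠ A : E →L[ℝ] E in 𝓝 1, 0 < A.det :=
    ContinuousLinearMap.continuous_det.continuousAt.eventually
      (lt_mem_nhds (by simp [ContinuousLinearMap.det]))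
  obtain ⟨ε, hε, hball⟩ := Metric.eventually_nhds_iff.mp hdet1
  refine ⟨min ε 1 / K, by positivity, fun t ht => ?_⟩
  have htK : t * K < min ε 1 := (lt_div_iff₀ hKpos).mp ht.2
  have hdet : ∀ x ∈ B, 0 < (1 + t • (fderiv ℝ g x - 1)).det := fun x hx => hball <| by
    rw [dist_eq_norm, add_sub_cancel_left, norm_smul, Real.norm_of_nonneg ht.1.le]
    exact lt_of_le_of_lt (mul_le_mul_of_nonneg_left (hK x hx) ht.1.le)
      (htK.trans_le (min_le_left _ _))
  have hbij : Function.Bijective fun x => x + t • w x := by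
    refine bijective_add_of_contracting (K := Real.toNNReal t * K)
      (LipschitzWith.of_dist_le_mul fun x y => ?_) ?_
    · rw [dist_smul₀, Real.norm_of_nonneg ht.1.le, NNReal.coe_mul, Real.coe_toNNReal _ ht.1.le,
        mul_assoc]
      exact mul_le_mul_of_nonneg_left (hw.dist_le_mul x y) ht.1.le
    · rw [← NNReal.coe_lt_coe, NNReal.coe_mul, Real.coe_toNNReal _ ht.1.le]
      exact htK.trans_le (min_le_right _ _)
  have himg : (fun x => x + t • w x) '' B = B :=
    image_eq_of_bijective_of_fixed hbij fun x hx => by simp [w, indicator_of_notMem hx]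
  have hd : ∀ x ∈ B, HasFDerivWithinAt (fun x => x + t • w x)
      (1 + t • (fderiv ℝ g x - 1)) B x := fun x hx =>
    HasFDerivWithinAt.congr
      ((hasFDerivAt_id x).add ((hder x).const_smul t)).hasFDerivWithinAt
      (fun y hy => by simp [w, indicator_of_mem hy]) (by simp [w, indicator_of_mem hx])
  have hcv := MeasureTheory.integral_image_eq_integral_abs_det_fderiv_smul μ
    measurableSet_closedBall hd hbij.1.injOn (fun _ => (1 : ℝ))
  rw [himg] at hcv
  simp only [MeasureTheory.integral_const, smul_eq_mul, mul_one,
    MeasureTheory.measureReal_restrict_apply_univ] at hcv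
  rw [hcv]
  exact MeasureTheory.setIntegral_congr_fun measurableSet_closedBall
    fun x hx => (abs_of_pos (hdet x hx)).symm

/-- There is no `C¹` map onto a sphere that fixes the sphere pointwise. -/
lemma not_contDiff_retraction [InnerProductSpace ℝ E] [FiniteDimensional ℝ E] {g : E → E} {R : ℝ}
    (hR : 0 < R) (hg : ContDiff ℝ 1 g) (hnorm : ∀ x, ‖g x‖ = R)
    (hfix : ∀ x ∈ sphere (0 : E) R, g x = x) : False := by
  borelize E
  let μ : MeasureTheory.Measure E := MeasureTheory.Measure.addHaar
  obtain ⟨δ, hδ, hint⟩ := exists_forall_integral_det_eq μ hg hfix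
  obtain ⟨τ, ω, hτ, hω, hp⟩ := exists_nodes_weights (Module.finrank ℝ E) hδ
  have hcont : ∀ t : ℝ, Continuous fun x => (1 + t • (fderiv ℝ g x - 1)).det := fun t =>
    ContinuousLinearMap.continuous_det.comp <| continuous_const.add <|
      ((hg.continuous_fderiv one_ne_zero).sub continuous_const).const_smul t
  have hzero : ∀ x, ∑ i, ω i * (1 + τ i • (fderiv ℝ g x - 1)).det = 0 := by
    intro x
    obtain ⟨p, hdeg, hpe⟩ := exists_polynomial_eval_eq_det (fderiv ℝ g x - 1)
    simp_rw [← hpe, ← hp p hdeg, hpe]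
    simpa using det_fderiv_eq_zero_of_norm_eq hR hnorm (hg.differentiable one_ne_zero x)
  have hsum : ∑ i, ω i * ∫ x in closedBall (0 : E) R,
      (1 + τ i • (fderiv ℝ g x - 1)).det ∂μ = 0 := by
    simp_rw [← MeasureTheory.integral_const_mul]
    rw [← MeasureTheory.integral_finsetSum]
    · simp [hzero]
    · exact fun i _ => (((hcont (τ i)).continuousOn.integrableOn_compact
        (isCompact_closedBall (0 : E) R))).const_mul (ω i)
  simp_rw [fun i => hint (τ i) (hτ i), ← Finset.sum_mul, hω, one_mul] at hsum
  exact (MeasureTheory.measureReal_ne_zero_iff (MeasureTheory.measure_closedBall_lt_top.ne)).mpr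
    (Metric.measure_closedBall_pos μ 0 hR).ne' hsum

/-- A continuous map of unit norm cannot agree with radial projection outside a ball. -/
lemma not_continuous_eq_radial [InnerProductSpace ℝ E] [FiniteDimensional ℝ E] {F : E → E}
    (hF : Continuous F) (hnorm : ∀ x, ‖F x‖ = 1)
    (hrad : ∀ x, 2 ≤ ‖x‖ → F x = ‖x‖⁻¹ • x) : False := by
  have hU : {x : E | 2 < ‖x‖} ∈ 𝓝ˢ {x : E | 3 ≤ ‖x‖} :=
    (isOpen_lt continuous_const continuous_norm).mem_nhdsSet.mpr
      fun x (hx : 3 ≤ ‖x‖) => show 2 < ‖x‖ by linarith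
  have hFU : ContDiffOn ℝ (1 : ℕ∞) F {x : E | 2 < ‖x‖} := by
    have h : ContDiffOn ℝ (1 : ℕ∞) (fun x : E => ‖x‖⁻¹ • x) {x : E | 2 < ‖x‖} := by
      have hne : ∀ x ∈ {x : E | 2 < ‖x‖}, x ≠ 0 := by
        rintro x hx rfl
        norm_num at hx
      exact ((contDiffOn_id.norm ℝ hne).inv fun x hx => norm_ne_zero_iff.mpr (hne x hx)).smul
        contDiffOn_id
    exact h.congr fun x (hx : 2 < ‖x‖) => hrad x hx.le
  obtain ⟨G, hG, happ, heq, -⟩ := hF.exists_contDiff_approx_and_eqOn 1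
    (continuous_const (y := (1 : ℝ))) (fun _ => one_pos)
    (isClosed_le continuous_const continuous_norm) hU hFU
  have hne : ∀ x, G x ≠ 0 := by
    intro x h0
    have := happ x
    rw [h0, dist_zero_left, hnorm] at this
    exact lt_irrefl _ this
  refine not_contDiff_retraction (g := fun x => (3 * ‖G x‖⁻¹) • G x) (R := 3) (by norm_num)
    ?_ ?_ ?_
  · exact (contDiff_const.mul ((hG.norm ℝ hne).inv fun x => norm_ne_zero_iff.mpr (hne x))).smul hG
  · intro x
    have := norm_ne_zero_iff.mpr (hne x)
    rw [norm_smul, norm_mul, norm_inv, norm_norm]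
    field_simp
    norm_num
  · intro x hx
    have hx3 : ‖x‖ = 3 := mem_sphere_zero_iff_norm.mp hx
    have hGx : G x = ‖x‖⁻¹ • x := (heq (show 3 ≤ ‖x‖ from hx3.ge)).trans (hrad x (by linarith))
    have hG1 : ‖G x‖ = 1 := by rw [hGx, ← hrad x (by linarith), hnorm]
    simp only [hG1]
    rw [hGx, hx3, smul_smul]
    norm_num

end NoRetraction

/-- **Lemma 3.8.** For `m ≥ 1` there is no continuous map from the closed unit `m`-ball
to its boundary sphere whose restriction to the sphere is homotopic to the identity. -/
theorem no_retraction_up_to_homotopy (m : ℕ) (hm : 1 ≤ m) :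
    ¬ ∃ f : C(Metric.closedBall (0 : EuclideanSpace ℝ (Fin m)) 1,
        Metric.sphere (0 : EuclideanSpace ℝ (Fin m)) 1),
      ContinuousMap.Homotopic
        (f.comp ⟨fun z : Metric.sphere (0 : EuclideanSpace ℝ (Fin m)) 1 =>
            (⟨(z : EuclideanSpace ℝ (Fin m)), Metric.sphere_subset_closedBall z.2⟩ :
              Metric.closedBall (0 : EuclideanSpace ℝ (Fin m)) 1),
          continuous_subtype_val.subtype_mk _⟩)
        (ContinuousMap.id (Metric.sphere (0 : EuclideanSpace ℝ (Fin m)) 1)) := by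
  rintro ⟨f, ⟨H⟩⟩
  let E := EuclideanSpace ℝ (Fin m)
  have hpolar : ∀ x : E, 1 ≤ ‖x‖ → ‖x‖⁻¹ • x ∈ sphere (0 : E) 1 := fun x hx => by
    have hx0 : ‖x‖ ≠ 0 := by positivity
    rw [mem_sphere_zero_iff_norm, norm_smul, norm_inv, norm_norm, inv_mul_cancel₀ hx0]
  let Φ : {x : E | 1 ≤ ‖x‖} → sphere (0 : E) 1 := fun x =>
    H (projIcc 0 1 zero_le_one (‖(x : E)‖ - 1), ⟨_, hpolar x x.2⟩)
  have hΦ : Continuous Φ := by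
    have hval : Continuous fun x : {x : E | 1 ≤ ‖x‖} => (x : E) := continuous_subtype_val
    have hinv : Continuous fun x : {x : E | 1 ≤ ‖x‖} => ‖(x : E)‖⁻¹ • (x : E) :=
      (hval.norm.fun_inv₀ fun x => (one_pos.trans_le x.2).ne').fun_smul hval
    exact H.continuous.comp ((continuous_projIcc.comp
      (hval.norm.sub continuous_const)).prodMk (hinv.subtype_mk _))
  let F : E → E := fun x =>
    if h : ‖x‖ ≤ 1 then f ⟨x, mem_closedBall_zero_iff.mpr h⟩ else Φ ⟨x, (not_le.mp h).le⟩
  have hF_out : ∀ x (h : 1 ≤ ‖x‖), F x = Φ ⟨x, h⟩ := by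
    intro x h
    by_cases h1 : ‖x‖ ≤ 1
    · have hx : ‖x‖ = 1 := le_antisymm h1 h
      simp [F, Φ, hx]
    · simp only [F, dif_neg h1]
  have hF_in : ContinuousOn F (closedBall 0 1) := by
    rw [continuousOn_iff_continuous_domRestrict]
    refine (continuous_subtype_val.comp f.continuous).congr fun x => ?_
    simp [F, mem_closedBall_zero_iff.mp x.2]
  have hF_out' : ContinuousOn F {x | 1 ≤ ‖x‖} := by
    rw [continuousOn_iff_continuous_domRestrict]
    exact (continuous_subtype_val.comp hΦ).congr fun x => (hF_out x x.2).symm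
  refine not_continuous_eq_radial (F := F) ?_ ?_ ?_
  · have h := hF_in.union_of_isClosed hF_out' isClosed_closedBall
      (isClosed_le continuous_const continuous_norm)
    rw [← continuousOn_univ]
    refine h.mono fun x _ => ?_
    rcases le_total ‖x‖ 1 with hx | hx
    · exact Or.inl (mem_closedBall_zero_iff.mpr hx)
    · exact Or.inr hx
  · intro x
    simp only [F]
    split_ifs <;> exact norm_eq_of_mem_sphere _
  · intro x hx
    have hx1 : 1 ≤ ‖x‖ := by linarith
    rw [hF_out x hx1]
    simp only [Φ]
    rw [projIcc_of_right_le _ (by linarith)]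
    exact congrArg Subtype.val (H.apply_one _)
end
end

section
/- Let m ≥ 1, let B̄ᵐ_R(0) be a closed m-ball centered at the origin, and let f: B̄ᵐ_R(0) → ℝᵐ be a continuous map such that ⟨f(y), y⟩ > 0 for every y with |y| = R. Then there exists r̄ > 0 such that the open ball Bᵐ_{r̄}(0) is contained in the image f(B̄ᵐ_R(0)). -/
open Set Metric Filter
open scoped RealInnerProductSpace ENNReal Topology

noncomputable section

section NoRetraction

variable {E : Type*} [NormedAddCommGroup E] [InnerProductSpace ℝ E]

/-- `t ↦ det (1 + t A)` is recovered from its values at more than `dim E` nodes by Lagrange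
interpolation. -/
theorem det_id_add_smul_eq_sum [FiniteDimensional ℝ E] (A : E →L[ℝ] E) (s : Finset ℝ)
    (hs : Module.finrank ℝ E < s.card) (t : ℝ) :
    (ContinuousLinearMap.id ℝ E + t • A).det =
      ∑ τ ∈ s, (ContinuousLinearMap.id ℝ E + τ • A).det * (Lagrange.basis s id τ).eval t := by
  classical
  let b := Module.finBasis ℝ E
  let M := LinearMap.toMatrix b b (A : E →ₗ[ℝ] E)
  let p : Polynomial ℝ := Matrix.det
    ((Polynomial.X : Polynomial ℝ) • M.map Polynomial.C + (1 : Matrix _ _ ℝ).map Polynomial.C)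
  have hp : ∀ u : ℝ, (ContinuousLinearMap.id ℝ E + u • A).det = p.eval u := by
    intro u
    have h1 : (ContinuousLinearMap.id ℝ E + u • A).det =
        LinearMap.det (LinearMap.id + u • (A : E →ₗ[ℝ] E)) := rfl
    rw [h1, ← LinearMap.det_toMatrix b, map_add, map_smul, LinearMap.toMatrix_id]
    rw [← Polynomial.coe_evalRingHom, RingHom.map_det]
    congr 1
    ext i j
    by_cases hij : i = j
    · subst hij
      simp [M]
      ring
    · simp [M, Matrix.one_apply_ne hij]
      ring
  have hdeg : p.degree < s.card := by
    refine lt_of_le_of_lt Polynomial.degree_le_natDegree ?_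
    have h := Polynomial.natDegree_det_X_add_C_le M 1
    rw [Fintype.card_fin] at h
    exact_mod_cast h.trans_lt hs
  have h := Lagrange.eq_interpolate (v := id) (s := s) (f := p) (Set.injOn_id _) hdeg
  have h2 := congrArg (Polynomial.eval t) h
  rw [Lagrange.interpolate_apply, Polynomial.eval_finsetSum] at h2
  rw [hp, h2]
  refine Finset.sum_congr rfl fun τ _ => ?_
  rw [hp, Polynomial.eval_mul, Polynomial.eval_C, id]

/-- A map that is Lipschitz on a closed ball and vanishes on the sphere is Lipschitz after being
extended by zero outside the open ball. -/
theorem LipschitzOnWith.lipschitzWith_indicator_ball {g : E → E} {ρ : ℝ} {L : NNReal}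
    (hg : LipschitzOnWith L g (closedBall 0 ρ)) (h0 : ∀ x, ‖x‖ = ρ → g x = 0) :
    LipschitzWith L ((ball (0 : E) ρ).indicator g) := by
  have key : ∀ x ∈ ball (0 : E) ρ, ∀ y ∉ ball (0 : E) ρ, dist (g x) 0 ≤ L * dist x y := by
    intro x hx y hy
    rw [mem_ball_zero_iff] at hx hy
    have hc : ContinuousOn (fun z : E => ‖z‖) (segment ℝ x y) := continuous_norm.continuousOn
    obtain ⟨z, hz, hzρ⟩ := (convex_segment x y).isPreconnected.intermediate_value
      (left_mem_segment ℝ x y) (right_mem_segment ℝ x y) hc ⟨hx.le, not_lt.1 hy⟩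
    have h1 := hg.dist_le_mul x (by simpa using hx.le) z (by simpa using hzρ.le)
    rw [h0 z hzρ] at h1
    refine h1.trans (mul_le_mul_of_nonneg_left ?_ L.2)
    have := dist_add_dist_of_mem_segment hz
    linarith [dist_nonneg (x := z) (y := y)]
  refine LipschitzWith.of_dist_le_mul fun x y => ?_
  by_cases hx : x ∈ ball (0 : E) ρ <;> by_cases hy : y ∈ ball (0 : E) ρ
  · rw [indicator_of_mem hx, indicator_of_mem hy]
    exact hg.dist_le_mul x (ball_subset_closedBall hx) y (ball_subset_closedBall hy)
  · rw [indicator_of_mem hx, indicator_of_notMem hy]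
    exact key x hx y hy
  · rw [indicator_of_notMem hx, indicator_of_mem hy, dist_comm, dist_comm x]
    exact key y hy x hx
  · rw [indicator_of_notMem hx, indicator_of_notMem hy, dist_self]
    positivity

/-- A small Lipschitz perturbation of the identity is bijective. -/
theorem LipschitzWith.bijective_id_add_smul [CompleteSpace E] {G : E → E} {L : NNReal}
    (hG : LipschitzWith L G) {t : ℝ} (ht : 0 ≤ t) (htL : t * L < 1) : Function.Bijective fun x => x + t • G x := by
  have hd : ∀ x y, dist (t • G x) (t • G y) ≤ t * L * dist x y := by
    intro x y
    rw [dist_smul₀, Real.norm_of_nonneg ht, mul_assoc]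
    exact mul_le_mul_of_nonneg_left (hG.dist_le_mul x y) ht
  constructor
  · intro x y hxy
    have h : x - y = t • G y - t • G x := by
      rw [sub_eq_sub_iff_add_eq_add, add_comm (t • G y)]; exact hxy
    have h1 := hd y x
    rw [dist_eq_norm, ← h, ← dist_eq_norm, dist_comm y x] at h1
    have : dist x y = 0 := by
      by_contra hne
      have := lt_of_le_of_ne dist_nonneg (Ne.symm hne)
      nlinarith
    exact dist_eq_zero.1 this
  · intro y
    have hc : ContractingWith (Real.toNNReal (t * L)) fun x => y - t • G x := by
      refine ⟨by simpa using htL, LipschitzWith.of_dist_le_mul fun a b => ?_⟩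
      rw [dist_sub_left, Real.coe_toNNReal _ (by positivity)]
      exact hd a b
    have h := hc.fixedPoint_isFixedPt
    exact ⟨ContractingWith.fixedPoint _ hc, (sub_eq_iff_eq_add.1 h).symm⟩

variable [FiniteDimensional ℝ E]

/-- There is no `C¹` retraction of a ball onto its boundary sphere. -/
theorem not_exists_contDiff_retraction {r : E → E} {ρ : ℝ} (hρ : 0 < ρ) (hr : ContDiff ℝ 1 r)
    (hnorm : ∀ x, ‖r x‖ = ρ) (hfix : ∀ x, ‖x‖ = ρ → r x = x) : False := by
  let _ : MeasurableSpace E := borel E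
  have : BorelSpace E := ⟨rfl⟩
  let μ : MeasureTheory.Measure E := MeasureTheory.volume
  let g : E → E := fun x => r x - x
  have hg : ContDiff ℝ 1 g := hr.sub contDiff_id
  let A : E → E →L[ℝ] E := fderiv ℝ g
  have : CompleteSpace E := FiniteDimensional.complete ℝ E
  have hA : Continuous A := hg.continuous_fderiv one_ne_zero
  have hgA : ∀ x, HasFDerivAt g (A x) x := fun x =>
    (hg.differentiable one_ne_zero x).hasFDerivAt
  let D : ℝ → E → ℝ := fun t x => (ContinuousLinearMap.id ℝ E + t • A x).det
  have hD : Continuous fun q : ℝ × E => D q.1 q.2 :=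
    ContinuousLinearMap.continuous_det.comp
      (continuous_const.add (continuous_fst.smul (hA.comp continuous_snd)))
  have hDt : ∀ t, Continuous (D t) := fun t => hD.comp (Continuous.prodMk_right t)
  have hK : IsCompact (closedBall (0 : E) ρ) := isCompact_closedBall _ _
  have hInt : ∀ t, MeasureTheory.IntegrableOn (D t) (ball 0 ρ) μ := fun t =>
    ((hDt t).continuousOn.integrableOn_compact hK).mono_set ball_subset_closedBall
  obtain ⟨L, hL⟩ := hg.contDiffOn.exists_lipschitzOnWith one_ne_zero
    (convex_closedBall (0 : E) ρ) hK
  have hG := hL.lipschitzWith_indicator_ball fun x hx => by simp [g, hfix x hx]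
  have hpos : ∀ᶠ t in 𝓝 (0 : ℝ), ∀ x ∈ closedBall (0 : E) ρ, 0 < D t x := by
    refine hK.eventually_forall_of_forall_eventually fun x _ => ?_
    refine hD.continuousAt.eventually (lt_mem_nhds ?_)
    simp [D, ContinuousLinearMap.det]
  have hsmall : ∀ᶠ t in 𝓝 (0 : ℝ), t * (L : ℝ) < 1 ∧ t < 1 := by
    refine (ContinuousAt.eventually_lt (by fun_prop) continuousAt_const (by simp)).and
      (gt_mem_nhds one_pos)
  obtain ⟨δ, hδ, hball⟩ := Metric.eventually_nhds_iff.1 (hpos.and hsmall)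
  have hvol : ∀ t ∈ Ioo 0 δ, ∫ x in ball 0 ρ, D t x ∂μ = μ.real (ball 0 ρ) := by
    intro t ht
    obtain ⟨hDpos, htL, ht1⟩ := hball (y := t) (by
      rw [dist_zero_right, Real.norm_of_nonneg ht.1.le]; exact ht.2)
    let F : E → E := fun x => x + t • g x
    have hbij := hG.bijective_id_add_smul ht.1.le htL
    have hFeq : ∀ x ∈ ball (0 : E) ρ, x + t • (ball (0 : E) ρ).indicator g x = F x := by
      intro x hx
      rw [indicator_of_mem hx]
    have hinj : InjOn F (ball 0 ρ) := fun x hx y hy hxy =>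
      hbij.1 (by simpa only [hFeq x hx, hFeq y hy] using hxy)
    have himg : F '' ball 0 ρ = ball 0 ρ := by
      refine Subset.antisymm ?_ fun y hy => ?_
      · rintro _ ⟨x, hx, rfl⟩
        rw [mem_ball_zero_iff] at hx ⊢
        have : F x = (1 - t) • x + t • r x := by simp only [F, g]; module
        rw [this]
        refine (norm_add_le _ _).trans_lt ?_
        rw [norm_smul, norm_smul, hnorm, Real.norm_of_nonneg ht.1.le,
          Real.norm_of_nonneg (by linarith)]
        nlinarith
      · obtain ⟨x, hx⟩ := hbij.2 y
        by_cases hxb : x ∈ ball (0 : E) ρ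
        · exact ⟨x, hxb, by rw [← hFeq x hxb]; exact hx⟩
        · simp only [indicator_of_notMem hxb, smul_zero, add_zero] at hx
          exact absurd (hx ▸ hy) hxb
    have hF : ∀ x ∈ ball (0 : E) ρ,
        HasFDerivWithinAt F (ContinuousLinearMap.id ℝ E + t • A x) (ball 0 ρ) x := fun x _ =>
      ((hasFDerivAt_id x).add ((hgA x).const_smul t)).hasFDerivWithinAt
    have h := MeasureTheory.integral_image_eq_integral_abs_det_fderiv_smul μ
      measurableSet_ball hF hinj fun _ => (1 : ℝ)
    rw [himg] at h
    rw [MeasureTheory.setIntegral_const, smul_eq_mul, mul_one] at h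
    rw [h]
    refine MeasureTheory.setIntegral_congr_fun measurableSet_ball fun x hx => ?_
    simp only [smul_eq_mul, mul_one]
    exact (abs_of_pos (hDpos x (ball_subset_closedBall hx))).symm
  obtain ⟨s, hsub, hcard⟩ := (Ioo_infinite hδ).exists_subset_card_eq (Module.finrank ℝ E + 1)
  have hlt : Module.finrank ℝ E < s.card := by omega
  have hone : ∫ x in ball 0 ρ, D 1 x ∂μ = μ.real (ball 0 ρ) := by
    have h1 : ∀ x, D 1 x = ∑ τ ∈ s, D τ x * (Lagrange.basis s id τ).eval 1 := fun x =>
      det_id_add_smul_eq_sum (A x) s hlt 1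
    simp only [h1]
    rw [MeasureTheory.integral_finsetSum _ fun τ _ => (hInt τ).mul_const _]
    have h2 : ∀ τ ∈ s, ∫ x in ball 0 ρ, D τ x * (Lagrange.basis s id τ).eval 1 ∂μ =
        μ.real (ball 0 ρ) * (Lagrange.basis s id τ).eval 1 := fun τ hτ => by
      rw [MeasureTheory.integral_mul_const, hvol τ (hsub hτ)]
    rw [Finset.sum_congr rfl h2, ← Finset.mul_sum, ← Polynomial.eval_finsetSum,
      Lagrange.sum_basis (Set.injOn_id _) (Finset.card_pos.1 (by omega)), Polynomial.eval_one,
      mul_one]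
  have hzero : ∀ x, D 1 x = 0 := by
    intro x
    by_contra hne
    have hB : HasFDerivAt r (ContinuousLinearMap.id ℝ E + (1 : ℝ) • A x) x := by
      have := (hasFDerivAt_id x).add (hgA x)
      rw [one_smul]
      convert this using 1
      ext y; simp [g]
    have hconst : HasFDerivAt (fun y => ‖r y‖ ^ 2) (0 : E →L[ℝ] ℝ) x := by
      simp only [hnorm]; exact hasFDerivAt_const _ _
    have huniq := hB.norm_sq.unique hconst
    have hsurj := (LinearMap.equivOfDetNeZero
      ((ContinuousLinearMap.id ℝ E + (1 : ℝ) • A x : E →L[ℝ] E) : E →ₗ[ℝ] E) hne).surjective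
    obtain ⟨v, hv⟩ := hsurj (r x)
    have hv' : (ContinuousLinearMap.id ℝ E + (1 : ℝ) • A x) v = r x := hv
    have h0 := congrArg (fun T : E →L[ℝ] ℝ => T v) huniq
    simp only [smul_apply, ContinuousLinearMap.comp_apply, hv',
      innerSL_apply_apply, real_inner_self_eq_norm_sq, hnorm, zero_apply] at h0
    have : ρ ^ 2 = 0 := by simpa using h0
    exact hρ.ne' (pow_eq_zero_iff two_ne_zero |>.1 this)
  have hμ : 0 < μ.real (ball (0 : E) ρ) :=
    ENNReal.toReal_pos (measure_ball_pos μ 0 hρ).ne' MeasureTheory.measure_ball_lt_top.ne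
  simp only [hzero, MeasureTheory.integral_zero] at hone
  exact hμ.ne hone

/-- A nowhere vanishing continuous map of `E` cannot be the identity outside a ball. -/
theorem not_exists_continuous_ne_zero {H : E → E} {ρ : ℝ} (hρ : 0 < ρ) (hH : Continuous H)
    (hne : ∀ x, H x ≠ 0) (hid : ∀ x, ρ ≤ ‖x‖ → H x = x) : False := by
  let T : E → Set E := fun x => {y | y ∈ ball (H x) ‖H x‖ ∧ (2 * ρ ≤ ‖x‖ → y = x)}
  have hT : ∀ x, Convex ℝ (T x) := by
    intro x
    refine (convex_ball (H x) ‖H x‖).inter fun y hy z hz a b _ _ hab hx => ?_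
    rw [hy hx, hz hx, ← add_smul, hab, one_smul]
  obtain ⟨K, hK⟩ := exists_contMDiffMap_forall_mem_convex_of_local (n := 1)
    (modelWithCornersSelf ℝ E) hT (by
      intro x
      by_cases hx : ‖x‖ < 2 * ρ
      · have h1 : ∀ᶠ y in 𝓝 x, H x ∈ ball (H y) ‖H y‖ := by
          have : ContinuousAt (fun y => dist (H x) (H y)) x := by fun_prop
          exact ContinuousAt.eventually_lt this hH.norm.continuousAt (by simpa using hne x)
        have h2 : ∀ᶠ y in 𝓝 x, ‖y‖ < 2 * ρ := continuousAt_id.norm.eventually_lt_const hx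
        refine ⟨_, h1.and h2, fun _ => H x, contMDiffOn_const, ?_⟩
        rintro y ⟨hy1, hy2⟩
        exact ⟨hy1, fun h => absurd hy2 (not_lt.2 h)⟩
      · have h2 : ∀ᶠ y in 𝓝 x, ρ < ‖y‖ :=
          continuousAt_id.norm.eventually_const_lt (by simp only [id]; linarith)
        refine ⟨_, h2, id, contMDiffOn_id, fun y hy => ?_⟩
        refine ⟨?_, fun _ => rfl⟩
        rw [hid y hy.le, id]
        exact mem_ball_self (hρ.trans hy))
  have hK1 : ContDiff ℝ 1 K := K.contMDiff.contDiff
  have hK0 : ∀ x, K x ≠ 0 := by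
    intro x h
    have := (hK x).1
    rw [h, mem_ball, dist_zero_left] at this
    exact lt_irrefl _ this
  refine not_exists_contDiff_retraction (r := fun x => (2 * ρ * ‖K x‖⁻¹) • K x)
    (ρ := 2 * ρ) (by positivity) ?_ ?_ ?_
  · exact (contDiff_const.mul ((hK1.norm ℝ hK0).inv fun x => norm_ne_zero_iff.2 (hK0 x))).smul hK1
  · intro x
    rw [norm_smul, Real.norm_of_nonneg (by positivity), mul_assoc,
      inv_mul_cancel₀ (norm_ne_zero_iff.2 (hK0 x)), mul_one]
  · intro x hx
    have : K x = x := (hK x).2 hx.ge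
    simp only [this, hx]
    rw [mul_inv_cancel₀ (by positivity), one_smul]

/-- A continuous vector field on a closed ball pointing outwards on the boundary has a zero. -/
theorem exists_eq_zero_of_inner_pos {f : E → E} {R : ℝ} (hR : 0 < R)
    (hf : ContinuousOn f (closedBall 0 R)) (hpos : ∀ y, ‖y‖ = R → 0 < ⟪f y, y⟫) :
    ∃ x ∈ closedBall (0 : E) R, f x = 0 := by
  by_contra! hne
  let P : E → E := fun x => (R / max R ‖x‖) • x
  let σ : E → ℝ := fun x => min 1 (max 0 (‖x‖ / R - 1))
  have hmax : ∀ x : E, 0 < max R ‖x‖ := fun x => hR.trans_le (le_max_left _ _)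
  have hP : Continuous P :=
    (continuous_const.div (continuous_const.max continuous_norm) fun x => (hmax x).ne').smul
      continuous_id
  have hσ : Continuous σ := by fun_prop
  have hPmem : ∀ x, P x ∈ closedBall (0 : E) R := by
    intro x
    rw [mem_closedBall_zero_iff, norm_smul, Real.norm_of_nonneg (div_nonneg hR.le (hmax x).le),
      div_mul_eq_mul_div, div_le_iff₀ (hmax x)]
    exact mul_le_mul_of_nonneg_left (le_max_right _ _) hR.le
  have hfP : Continuous fun x => f (P x) := hf.comp_continuous hP hPmem
  refine not_exists_continuous_ne_zero (H := fun x => (1 - σ x) • f (P x) + σ x • x)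
    (ρ := 2 * R) (by positivity)
    (((continuous_const.sub hσ).smul hfP).add (hσ.smul continuous_id)) ?_ ?_
  · intro x
    rcases le_or_gt ‖x‖ R with hx | hx
    · have h1 : σ x = 0 := by
        have : ‖x‖ / R - 1 ≤ 0 := by rw [sub_nonpos, div_le_one hR]; exact hx
        simp [σ, max_eq_left this]
      have h2 : P x = x := by simp [P, max_eq_left hx, hR.ne']
      simpa [h1, h2] using hne x (by simpa using hx)
    · intro h
      have hx0 : 0 < ‖x‖ := hR.trans hx
      have hPn : ‖P x‖ = R := by
        simp only [P, max_eq_right hx.le]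
        rw [norm_smul, Real.norm_of_nonneg (by positivity), div_mul_cancel₀ _ hx0.ne']
      have h1 : 0 < ⟪f (P x), x⟫ := by
        have := hpos _ hPn
        simp only [P] at this
        rw [inner_smul_right] at this
        exact pos_of_mul_pos_right this (div_nonneg hR.le (hmax x).le)
      have hσ0 : 0 < σ x := by
        refine lt_min one_pos (lt_max_of_lt_right ?_)
        rw [sub_pos, one_lt_div hR]; exact hx
      have hσ1 : σ x ≤ 1 := min_le_left _ _
      have h2 := congrArg (fun z => ⟪z, x⟫) h
      simp only [inner_add_left, real_inner_smul_left, inner_zero_left,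
        real_inner_self_eq_norm_sq] at h2
      have h3 : 0 ≤ (1 - σ x) * ⟪f (P x), x⟫ := mul_nonneg (by linarith) h1.le
      have h4 : 0 < σ x * ‖x‖ ^ 2 := by positivity
      linarith
  · intro x hx
    have : σ x = 1 := by
      have h1 : 1 ≤ ‖x‖ / R - 1 := by
        have : 2 ≤ ‖x‖ / R := (le_div_iff₀ hR).2 hx
        linarith
      exact min_eq_left (h1.trans (le_max_right _ _))
    simp [this]

end NoRetraction

/-- **Lemma 3.9.** If `f` is continuous on the closed ball `B̄ᵐ_R(0)` and
`⟨f(y), y⟩ > 0` on the boundary sphere, then the image of `f` contains a small ball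
around the origin. -/
theorem surjects_onto_small_ball (m : ℕ) (hm : 1 ≤ m) (R : ℝ) (hR : 0 < R)
    (f : EuclideanSpace ℝ (Fin m) → EuclideanSpace ℝ (Fin m))
    (hf : ContinuousOn f (Metric.closedBall 0 R))
    (hpos : ∀ y : EuclideanSpace ℝ (Fin m), ‖y‖ = R → 0 < ⟪f y, y⟫) :
    ∃ r > (0:ℝ), Metric.ball 0 r ⊆ f '' Metric.closedBall 0 R := by
  have hcont : ContinuousOn (fun y => ⟪f y, y⟫) (sphere (0 : EuclideanSpace ℝ (Fin m)) R) :=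
    (hf.mono sphere_subset_closedBall).inner continuousOn_id
  obtain ⟨δ, hδ, hle⟩ := (isCompact_sphere (0 : EuclideanSpace ℝ (Fin m)) R).exists_forall_le'
    hcont (a := 0) fun y hy => hpos y (by simpa using hy)
  refine ⟨δ / R, by positivity, fun p hp => ?_⟩
  obtain ⟨x, hx, hx0⟩ := exists_eq_zero_of_inner_pos hR (f := fun y => f y - p)
    (hf.sub continuousOn_const) fun y hy => by
      rw [inner_sub_left, sub_pos]
      refine ((real_inner_le_norm p y).trans_lt ?_).trans_le (hle y (by simpa using hy))
      rw [hy]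
      exact (lt_div_iff₀ hR).1 (by simpa using hp)
  exact ⟨x, hx, sub_eq_zero.1 hx0⟩
end
end

section
/- Let Ω ⊂ ℝⁿ be an open set with nonempty boundary. Suppose x = 0 ∈ Ω \ Σ̄ with π(0) = {ξ}, where ξ = d·e_n with d = d(0) > 0, and suppose ξ has non-spreading inner perpendicular. Choose ε₀ > 0 with B_{ε₀}(0) ⊂ Ω \ Σ̄ and a neighborhood U_ξ of ξ in which ∂Ω is the graph of a function over the hyperplane orthogonal to e_n, and choose 0 < ε₁ < ε₀ such that the lower semi-sphere S = {y ∈ B_{ε₀}(0) : ⟨y, e_n⟩ ≤ 0, |y| = ε₁} satisfies π̂(S) ⊂ U_ξ. Then there exists r̄ > 0 such that B_{r̄}(ξ) ∩ ∂Ω ⊂ π̂(S). -/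
open Set Metric Filter
open scoped RealInnerProductSpace ENNReal Topology

noncomputable section

section MetricProjection

variable {n : ℕ} {Ω : Set (EuclideanSpace ℝ (Fin n))}

theorem mem_mproj_of_le {x ξ : EuclideanSpace ℝ (Fin n)} (hξ : ξ ∈ frontier Ω)
    (h : dist x ξ ≤ infDist x (frontier Ω)) : ξ ∈ mproj Ω x :=
  ⟨hξ, le_antisymm h (infDist_le_dist_of_mem hξ)⟩

/-- A single-valued selection of the metric projection is continuous. -/
theorem continuousAt_of_mproj_eq_singleton {B : Set (EuclideanSpace ℝ (Fin n))}
    {proj : EuclideanSpace ℝ (Fin n) → EuclideanSpace ℝ (Fin n)} (hB : IsOpen B)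
    (hproj : ∀ y ∈ B, mproj Ω y = {proj y}) {y : EuclideanSpace ℝ (Fin n)} (hy : y ∈ B) :
    ContinuousAt proj y := by
  rw [Metric.continuousAt_iff']
  intro ε hε
  set F := frontier Ω \ ball (proj y) ε with hF
  have hFc : IsClosed F := isClosed_frontier.sdiff isOpen_ball
  have key : F.Nonempty → infDist y (frontier Ω) < infDist y F := by
    intro hFne
    obtain ⟨ζ, hζ, hζd⟩ := hFc.exists_infDist_eq_dist hFne y
    rw [hζd]
    refine lt_of_le_of_ne (infDist_le_dist_of_mem hζ.1) fun h => hζ.2 ?_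
    have : ζ ∈ mproj Ω y := ⟨hζ.1, h.symm⟩
    rw [hproj y hy, mem_singleton_iff] at this
    rw [this]
    exact mem_ball_self hε
  have hmem : ∀ z ∈ B, proj z ∈ mproj Ω z := fun z hz => by rw [hproj z hz]; rfl
  rcases F.eq_empty_or_nonempty with hFe | hFne
  · filter_upwards [hB.mem_nhds hy] with z hz
    by_contra hlt
    have : proj z ∈ F := ⟨(hmem z hz).1, hlt⟩
    rw [hFe] at this
    exact this
  · have hev := ((continuous_infDist_pt (frontier Ω)).continuousAt (x := y)).eventually_lt
      ((continuous_infDist_pt F).continuousAt (x := y)) (key hFne)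
    filter_upwards [hB.mem_nhds hy, hev] with z hz hzlt
    by_contra hlt
    have : proj z ∈ F := ⟨(hmem z hz).1, hlt⟩
    exact absurd (infDist_le_dist_of_mem (x := z) this)
      (not_le.2 ((hmem z hz).2.trans_lt hzlt))

/-- The distance function grows at unit rate when moving away from the nearest point. -/
theorem eventually_infDist_add_lt {w ν : EuclideanSpace ℝ (Fin n)}
    {B : Set (EuclideanSpace ℝ (Fin n))}
    {proj : EuclideanSpace ℝ (Fin n) → EuclideanSpace ℝ (Fin n)} (hB : IsOpen B)
    (hproj : ∀ y ∈ B, mproj Ω y = {proj y}) (hw : w ∈ B)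
    (hpos : 0 < infDist w (frontier Ω)) (hν : ‖ν‖ = 1)
    (hwν : w - proj w = infDist w (frontier Ω) • ν) {c : ℝ} (hc0 : 0 ≤ c) (hc1 : c < 1) :
    ∀ᶠ s in 𝓝[>] (0 : ℝ), infDist w (frontier Ω) + c * s < infDist (w + s • ν) (frontier Ω) := by
  have hcont : ContinuousAt (fun s : ℝ => w + s • ν) 0 := by fun_prop
  have hpc : ContinuousAt (fun s : ℝ => proj (w + s • ν)) 0 := by
    refine ContinuousAt.comp (g := proj) ?_ hcont
    simpa using continuousAt_of_mproj_eq_singleton hB hproj hw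
  have hic : ContinuousAt (fun s : ℝ => ⟪ν, w - proj (w + s • ν)⟫) 0 :=
    continuousAt_const.inner (continuousAt_const.sub hpc)
  have hval : c * infDist w (frontier Ω) < ⟪ν, w - proj (w + (0 : ℝ) • ν)⟫ := by
    rw [zero_smul, add_zero, hwν, inner_smul_right, real_inner_self_eq_norm_sq, hν]
    nlinarith
  have hBe : ∀ᶠ s : ℝ in 𝓝 0, w + s • ν ∈ B :=
    hcont.eventually (hB.mem_nhds (by simpa using hw))
  filter_upwards [nhdsWithin_le_nhds hBe, nhdsWithin_le_nhds (hic.eventually_const_lt hval),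
    self_mem_nhdsWithin] with s hsB hsi hs
  have hs : 0 < s := hs
  have hm : proj (w + s • ν) ∈ mproj Ω (w + s • ν) := by rw [hproj _ hsB]; rfl
  have hle : infDist w (frontier Ω) ≤ ‖w - proj (w + s • ν)‖ := by
    rw [← dist_eq_norm]; exact infDist_le_dist_of_mem hm.1
  refine lt_of_pow_lt_pow_left₀ 2 infDist_nonneg ?_
  rw [← hm.2, dist_eq_norm, add_sub_right_comm, norm_add_sq_real, norm_smul, hν,
    inner_smul_right, real_inner_comm, Real.norm_eq_abs, mul_one, sq_abs]
  have h1 : infDist w (frontier Ω) ^ 2 ≤ ‖w - proj (w + s • ν)‖ ^ 2 := by gcongr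
  have h2 : s * (c * infDist w (frontier Ω)) < s * ⟪ν, w - proj (w + s • ν)⟫ := by gcongr
  have h3 : (c * s) ^ 2 ≤ s ^ 2 := by
    gcongr
    nlinarith
  nlinarith

/-- Normals can be prolonged inside the region of uniqueness of the metric projection. -/
theorem exists_wbtw_mem_mproj {B : Set (EuclideanSpace ℝ (Fin n))}
    {proj : EuclideanSpace ℝ (Fin n) → EuclideanSpace ℝ (Fin n)} (hB : IsOpen B)
    (hproj : ∀ y ∈ B, mproj Ω y = {proj y}) (hpos : ∀ y ∈ B, 0 < infDist y (frontier Ω))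
    {y : EuclideanSpace ℝ (Fin n)} {t : ℝ} (ht : 0 ≤ t) (hyB : closedBall y t ⊆ B) :
    ∃ w, dist w y = t ∧ Wbtw ℝ (proj y) y w ∧ proj y ∈ mproj Ω w := by
  have hy : y ∈ B := hyB (mem_closedBall_self ht)
  have hmy : proj y ∈ mproj Ω y := by rw [hproj y hy]; rfl
  have hcpt : IsCompact (closedBall y t) := isCompact_closedBall y t
  have hne : (closedBall y t).Nonempty := ⟨y, mem_closedBall_self ht⟩
  obtain ⟨w, hw, hmax⟩ := hcpt.exists_isMaxOn hne (continuous_infDist_pt (frontier Ω)).continuousOn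
  have hgrow : ∀ c : ℝ, 0 ≤ c → c < 1 →
      infDist y (frontier Ω) + c * t ≤ infDist w (frontier Ω) := by
    intro c hc0 hc1
    obtain ⟨x, hx, hxmax⟩ := hcpt.exists_isMaxOn hne
      (f := fun z => infDist z (frontier Ω) - c * dist z y)
      (((continuous_infDist_pt (frontier Ω)).sub (by fun_prop)).continuousOn)
    have hxy : dist x y = t := by
      refine le_antisymm hx (not_lt.1 fun hlt => ?_)
      have hxB := hyB hx
      have hxp := hpos x hxB
      have hmx : proj x ∈ mproj Ω x := by rw [hproj x hxB]; rfl
      set c' := (1 + c) / 2 with hc'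
      set ν := (infDist x (frontier Ω))⁻¹ • (x - proj x) with hνdef
      have hν : ‖ν‖ = 1 := by
        rw [hνdef, norm_smul, ← dist_eq_norm, hmx.2, norm_inv, Real.norm_of_nonneg hxp.le,
          inv_mul_cancel₀ hxp.ne']
      have hxν : x - proj x = infDist x (frontier Ω) • ν := by
        rw [hνdef, smul_smul, mul_inv_cancel₀ hxp.ne', one_smul]
      have hball : ∀ᶠ s : ℝ in 𝓝 0, x + s • ν ∈ closedBall y t := by
        have hcont : ContinuousAt (fun s : ℝ => x + s • ν) 0 := by fun_prop
        refine hcont.eventually (mem_of_superset (isOpen_ball.mem_nhds ?_) ball_subset_closedBall)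
        simpa using hlt
      obtain ⟨s, hs1, hs2, hs3⟩ := ((eventually_infDist_add_lt hB hproj hxB hxp hν hxν
        (c := c') (by positivity) (by linarith)).and
        ((hball.filter_mono nhdsWithin_le_nhds).and
        (self_mem_nhdsWithin : Ioi (0 : ℝ) ∈ 𝓝[>] (0 : ℝ)))).exists
      have hs3 : 0 < s := hs3
      have h4 : infDist (x + s • ν) (frontier Ω) - c * dist (x + s • ν) y ≤
          infDist x (frontier Ω) - c * dist x y := hxmax hs2
      have h5 : dist (x + s • ν) y ≤ s + dist x y := by
        refine (dist_triangle _ x _).trans ?_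
        rw [dist_self_add_left, norm_smul, hν, Real.norm_of_nonneg hs3.le, mul_one]
      have h6 : c * dist (x + s • ν) y ≤ c * (s + dist x y) := by gcongr
      nlinarith
    have h1 : infDist y (frontier Ω) - c * dist y y ≤ infDist x (frontier Ω) - c * dist x y :=
      hxmax (mem_closedBall_self ht)
    have h2 : infDist x (frontier Ω) ≤ infDist w (frontier Ω) := hmax hx
    rw [hxy, dist_self] at h1
    linarith
  have hfull : infDist y (frontier Ω) + t ≤ infDist w (frontier Ω) := by
    have hlim : Tendsto (fun c : ℝ => infDist y (frontier Ω) + c * t) (𝓝[<] 1)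
        (𝓝 (infDist y (frontier Ω) + 1 * t)) :=
      Tendsto.mono_left (Continuous.tendsto (by fun_prop) 1) nhdsWithin_le_nhds
    rw [one_mul] at hlim
    refine le_of_tendsto hlim ?_
    filter_upwards [self_mem_nhdsWithin,
      nhdsWithin_le_nhds (eventually_ge_nhds (zero_lt_one' ℝ))] with c hc1 hc0
    exact hgrow c hc0 hc1
  have h1 : infDist w (frontier Ω) ≤ dist w (proj y) := infDist_le_dist_of_mem hmy.1
  have h2 : dist w (proj y) ≤ dist w y + dist y (proj y) := dist_triangle _ _ _
  have h3 : dist w y ≤ t := hw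
  have h4 := hmy.2
  refine ⟨w, by linarith, ?_, mem_mproj_of_le hmy.1 (by linarith)⟩
  rw [← dist_add_dist_eq_iff, dist_comm (proj y) y, dist_comm y w, dist_comm (proj y) w]
  linarith

/-- A nearest point of `w` is a nearest point of every point between it and `w`. -/
theorem mem_mproj_of_wbtw {w z η : EuclideanSpace ℝ (Fin n)} (h : η ∈ mproj Ω w)
    (hz : Wbtw ℝ η z w) : η ∈ mproj Ω z := by
  refine mem_mproj_of_le h.1 ?_
  have h1 := hz.dist_add_dist
  have h2 : infDist w (frontier Ω) ≤ infDist z (frontier Ω) + dist w z := infDist_le_infDist_add_dist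
  rw [dist_comm η z, dist_comm z w, dist_comm η w, h.2] at h1
  linarith

/-- The convex function `(‖x‖² - d(x)²) / 2` has the metric projection as subgradient. -/
theorem subgradient_of_mem_mproj {x y ξ : EuclideanSpace ℝ (Fin n)} (h : ξ ∈ mproj Ω x) :
    ‖x‖ ^ 2 - infDist x (frontier Ω) ^ 2 + 2 * ⟪y - x, ξ⟫ ≤
      ‖y‖ ^ 2 - infDist y (frontier Ω) ^ 2 := by
  have h1 : infDist y (frontier Ω) ^ 2 ≤ dist y ξ ^ 2 := by
    have := infDist_le_dist_of_mem (x := y) h.1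
    gcongr
    exact infDist_nonneg
  rw [← h.2]
  rw [dist_eq_norm, norm_sub_sq_real] at h1 ⊢
  rw [inner_sub_left]
  linarith

end MetricProjection

theorem snocE_castSucc {m : ℕ} (z : EuclideanSpace ℝ (Fin m)) (t : ℝ) (i : Fin m) :
    snocE m z t i.castSucc = z i := by
  simp [snocE]

/-- **Lemma 3.10.** With `x = 0 ∈ Ω \ Σ̄`, `π(0) = {ξ}`, `ξ = d·eₙ` having non-spreading
inner perpendicular, `∂Ω` a graph over the hyperplane orthogonal to `eₙ` inside `U_ξ`,
and `S` the lower semi-sphere of radius `ε₁` with `π̂(S) ⊆ U_ξ`, the image `π̂(S)`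
contains `B_r̄(ξ) ∩ ∂Ω` for some `r̄ > 0`. -/
theorem image_of_lower_semisphere (m : ℕ) (hm : 1 ≤ m)
    (Ω : Set (EuclideanSpace ℝ (Fin (m + 1)))) (hΩ : IsOpen Ω) (hne : (frontier Ω).Nonempty)
    (d : ℝ) (hd : 0 < d) (hdist : d = Metric.infDist 0 (frontier Ω))
    (ξ : EuclideanSpace ℝ (Fin (m + 1)))
    (hξ : ξ = d • EuclideanSpace.single (Fin.last m) (1 : ℝ))
    (hx : (0 : EuclideanSpace ℝ (Fin (m + 1))) ∈ Ω \ cutLocus Ω)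
    (hπ : mproj Ω 0 = {ξ}) (hns : NonSpreadingPerp Ω ξ)
    (ε₀ : ℝ) (hε₀ : 0 < ε₀) (hball : Metric.ball 0 ε₀ ⊆ Ω \ cutLocus Ω)
    (Uξ : Set (EuclideanSpace ℝ (Fin (m + 1)))) (hU : Uξ ∈ 𝓝 ξ)
    (D : Set (EuclideanSpace ℝ (Fin m))) (g : EuclideanSpace ℝ (Fin m) → ℝ)
    (hgraph : frontier Ω ∩ Uξ = (fun z => snocE m z (g z)) '' D)
    (ε₁ : ℝ) (hε₁ : 0 < ε₁) (hε₁₀ : ε₁ < ε₀)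
    (S : Set (EuclideanSpace ℝ (Fin (m + 1))))
    (hS : S = {y | y ∈ Metric.ball (0 : EuclideanSpace ℝ (Fin (m + 1))) ε₀ ∧
        y (Fin.last m) ≤ 0 ∧ ‖y‖ = ε₁})
    (hπS : ∀ y ∈ S, mproj Ω y ⊆ Uξ) :
    ∃ r > (0:ℝ), ∀ η ∈ Metric.ball ξ r ∩ frontier Ω, ∃ y ∈ S, mproj Ω y = {η} := by
  have huniq : ∀ y ∈ ball (0 : EuclideanSpace ℝ (Fin (m + 1))) ε₀, ∃ ζ, mproj Ω y = {ζ} := by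
    intro y hy
    by_contra hcon
    exact (hball hy).2 ⟨(hball hy).1, subset_closure ⟨(hball hy).1, hcon⟩⟩
  choose! proj hproj using huniq
  have hmem : ∀ y ∈ ball (0 : EuclideanSpace ℝ (Fin (m + 1))) ε₀, proj y ∈ mproj Ω y :=
    fun y hy => by rw [hproj y hy]; rfl
  have h0B : (0 : EuclideanSpace ℝ (Fin (m + 1))) ∈ ball 0 ε₀ := mem_ball_self hε₀
  have hproj0 : proj 0 = ξ := singleton_injective ((hproj 0 h0B).symm.trans hπ)
  have hξm : ξ ∈ mproj Ω 0 := by rw [hπ]; rfl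
  have hpos : ∀ y ∈ ball (0 : EuclideanSpace ℝ (Fin (m + 1))) ε₀, 0 < infDist y (frontier Ω) := by
    intro y hy
    refine (isClosed_frontier.notMem_iff_infDist_pos hne).1 fun hyf => ?_
    exact (hΩ.inter_frontier_eq ▸ (⟨(hball hy).1, hyf⟩ : y ∈ Ω ∩ frontier Ω) : y ∈ (∅ : Set _))
  have hcont : ∀ y ∈ ball (0 : EuclideanSpace ℝ (Fin (m + 1))) ε₀, ContinuousAt proj y :=
    fun y hy => continuousAt_of_mproj_eq_singleton isOpen_ball hproj hy
  have hξlast : ξ (Fin.last m) = d := by simp [hξ]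
  have hinner : ∀ y : EuclideanSpace ℝ (Fin (m + 1)), ⟪y, ξ⟫ = d * y (Fin.last m) := by
    intro y
    rw [hξ, inner_smul_right, EuclideanSpace.inner_single_right]
    simp
  have hflat : ∀ y ∈ ball (0 : EuclideanSpace ℝ (Fin (m + 1))) ε₀, y (Fin.last m) = 0 →
      ξ ∈ mproj Ω y → y = 0 := by
    intro y hy hylast hξy
    rcases hns with hemp | ⟨p, v, -, hline, -⟩
    · exact ((hemp ▸ (⟨hx.1, hπ⟩ : _ ∈ {y | y ∈ Ω ∧ mproj Ω y = {ξ}}) :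
        (0 : EuclideanSpace ℝ (Fin (m + 1))) ∈ (∅ : Set _))).elim
    · have hfib : ∀ z ∈ ball (0 : EuclideanSpace ℝ (Fin (m + 1))) ε₀, ξ ∈ mproj Ω z →
          ∃ t : ℝ, z = p + t • v := by
        intro z hz hξz
        refine hline ⟨(hball hz).1, ?_⟩
        rw [hproj z hz, mem_singleton_iff] at hξz
        rw [hproj z hz, hξz]
      have hw : ∃ s : ℝ, 0 < s ∧ s ≤ 1 ∧ s • ξ ∈ ball (0 : EuclideanSpace ℝ (Fin (m + 1))) ε₀ := by
        have hev : ∀ᶠ s : ℝ in 𝓝 0, s • ξ ∈ ball (0 : EuclideanSpace ℝ (Fin (m + 1))) ε₀ := by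
          have hc : ContinuousAt (fun s : ℝ => s • ξ) 0 := by fun_prop
          exact hc.eventually (isOpen_ball.mem_nhds (by simpa using hε₀))
        obtain ⟨s, ⟨hs1, hs2⟩, hs3⟩ := (((hev.filter_mono nhdsWithin_le_nhds).and
          ((eventually_le_nhds (zero_lt_one' ℝ)).filter_mono nhdsWithin_le_nhds)).and
          (self_mem_nhdsWithin : Ioi (0 : ℝ) ∈ 𝓝[>] (0 : ℝ))).exists
        exact ⟨s, hs3, hs2, hs1⟩
      obtain ⟨s, hs0, hs1, hsB⟩ := hw
      have hsm : ξ ∈ mproj Ω (s • ξ) := by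
        refine mem_mproj_of_wbtw hξm (Wbtw.symm ⟨s, ⟨hs0.le, hs1⟩, ?_⟩)
        simp [AffineMap.lineMap_apply]
      obtain ⟨t₀, ht₀⟩ := hfib 0 h0B hξm
      obtain ⟨t₁, ht₁⟩ := hfib _ hsB hsm
      obtain ⟨t₂, ht₂⟩ := hfib y hy hξy
      have e0 : p (Fin.last m) + t₀ * v (Fin.last m) = 0 := by
        simpa using (congrArg (fun z : EuclideanSpace ℝ (Fin (m + 1)) => z (Fin.last m)) ht₀).symm
      have e1 : p (Fin.last m) + t₁ * v (Fin.last m) = s * d := by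
        simpa [hξlast] using
          (congrArg (fun z : EuclideanSpace ℝ (Fin (m + 1)) => z (Fin.last m)) ht₁).symm
      have e2 : p (Fin.last m) + t₂ * v (Fin.last m) = 0 := by
        have := congrArg (fun z : EuclideanSpace ℝ (Fin (m + 1)) => z (Fin.last m)) ht₂
        simp only [hylast] at this
        simpa using this.symm
      have hv : v (Fin.last m) ≠ 0 := by
        intro hv
        rw [hv] at e0 e1
        have := mul_pos hs0 hd
        linarith
      have ht : t₂ = t₀ := mul_right_cancel₀ hv (by linarith)
      rw [ht₂, ht, ← ht₀]
  -- a flat disk in the hyperplane through `0`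
  obtain ⟨ρ₀, hρ₀, hρU⟩ : ∃ ρ₀ > 0, ∀ y : EuclideanSpace ℝ (Fin (m + 1)),
      dist y 0 < ρ₀ → proj y ∈ Uξ :=
    Metric.eventually_nhds_iff.1 ((hcont 0 h0B).eventually (hproj0.symm ▸ hU))
  obtain ⟨ρ, hρ, hρ1, hρ2, hρ3⟩ : ∃ ρ > 0, ρ < ρ₀ ∧ ρ ≤ ε₁ ∧ ε₁ + 2 * ρ < ε₀ := by
    refine ⟨min (ρ₀ / 2) (min ε₁ ((ε₀ - ε₁) / 4)), ?_, ?_, ?_, ?_⟩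
    · refine lt_min (by linarith) (lt_min hε₁ (by linarith))
    · exact (min_le_left _ _).trans_lt (by linarith)
    · exact (min_le_right _ _).trans (min_le_left _ _)
    · have : min (ρ₀ / 2) (min ε₁ ((ε₀ - ε₁) / 4)) ≤ (ε₀ - ε₁) / 4 :=
        (min_le_right _ _).trans (min_le_right _ _)
      linarith
  set H : Set (EuclideanSpace ℝ (Fin (m + 1))) := {y | y (Fin.last m) = 0} with hH
  have hHc : IsClosed H := isClosed_eq (by fun_prop) continuous_const
  set ψ : EuclideanSpace ℝ (Fin (m + 1)) → ℝ :=
    fun y => ‖y‖ ^ 2 - infDist y (frontier Ω) ^ 2 with hψ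
  have hψc : Continuous ψ := by
    have := continuous_infDist_pt (frontier Ω)
    fun_prop
  have hψ0 : ∀ y ∈ sphere (0 : EuclideanSpace ℝ (Fin (m + 1))) ρ ∩ H, ψ 0 < ψ y := by
    rintro y ⟨hyρ, hyH⟩
    have hyn : ‖y‖ = ρ := by simpa using hyρ
    have hyH : y (Fin.last m) = 0 := hyH
    have hyB : y ∈ ball (0 : EuclideanSpace ℝ (Fin (m + 1))) ε₀ := by
      rw [mem_ball_zero_iff]; linarith
    have hlt : infDist y (frontier Ω) < dist y ξ := by
      refine lt_of_le_of_ne (infDist_le_dist_of_mem hξm.1) fun h => ?_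
      have := hflat y hyB hyH ⟨hξm.1, h.symm⟩
      rw [this, norm_zero] at hyn
      linarith
    have h1 : infDist y (frontier Ω) ^ 2 < dist y ξ ^ 2 :=
      pow_lt_pow_left₀ hlt infDist_nonneg two_ne_zero
    rw [dist_eq_norm, norm_sub_sq_real, hinner, hyH] at h1
    have h2 := hξm.2
    rw [dist_zero_left] at h2
    simp only [hψ, ← h2, norm_zero]
    linarith
  obtain ⟨κ, hκ, hκψ⟩ : ∃ κ > 0, ∀ y ∈ sphere (0 : EuclideanSpace ℝ (Fin (m + 1))) ρ ∩ H,
      ψ 0 + κ ≤ ψ y := by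
    rcases (sphere (0 : EuclideanSpace ℝ (Fin (m + 1))) ρ ∩ H).eq_empty_or_nonempty with he | hn
    · exact ⟨1, one_pos, fun y hy => by rw [he] at hy; exact hy.elim⟩
    · obtain ⟨y₀, hy₀, hmin⟩ :=
        ((isCompact_sphere _ _).inter_right hHc).exists_isMinOn hn hψc.continuousOn
      refine ⟨ψ y₀ - ψ 0, sub_pos.2 (hψ0 y₀ hy₀), fun y hy => ?_⟩
      have : ψ y₀ ≤ ψ y := hmin hy
      linarith
  obtain ⟨rU, hrU, hrUU⟩ := Metric.mem_nhds_iff.1 hU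
  refine ⟨min (κ / (2 * ρ)) (min rU d), lt_min (by positivity) (lt_min hrU hd), ?_⟩
  rintro η ⟨hη, hηf⟩
  rw [mem_ball, lt_min_iff, lt_min_iff] at hη
  obtain ⟨hη1, hη2, hη3⟩ := hη
  have hηpos : 0 < η (Fin.last m) := by
    have h1 : |(η - ξ) (Fin.last m)| ≤ ‖η - ξ‖ := by
      simpa using PiLp.norm_apply_le (η - ξ) (Fin.last m)
    rw [← dist_eq_norm, PiLp.sub_apply, hξlast] at h1
    have := (abs_le.1 h1).1
    linarith
  -- a minimiser on the disk is mapped to `η` by the projection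
  obtain ⟨y, ⟨hyρ, hyH⟩, hymin⟩ := ((isCompact_closedBall (0 : EuclideanSpace ℝ (Fin (m + 1)))
    ρ).inter_right hHc).exists_isMinOn (f := fun y => ψ y - 2 * ⟪y, η⟫)
    ⟨0, mem_closedBall_self hρ.le, by simp [hH]⟩ (by fun_prop)
  have hyH : y (Fin.last m) = 0 := hyH
  have hyn : ‖y‖ ≤ ρ := by simpa using hyρ
  have hyB : y ∈ ball (0 : EuclideanSpace ℝ (Fin (m + 1))) ε₀ := by
    rw [mem_ball_zero_iff]; linarith
  have hylt : ‖y‖ < ρ := by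
    refine lt_of_le_of_ne hyn fun h => ?_
    have h1 : ψ y - 2 * ⟪y, η⟫ ≤ ψ 0 - 2 * ⟪0, η⟫ :=
      hymin ⟨mem_closedBall_self hρ.le, by simp [hH]⟩
    have h2 := hκψ y ⟨by simpa using h, hyH⟩
    have h3 : ⟪y, η⟫ = ⟪y, η - ξ⟫ := by rw [inner_sub_right, hinner, hyH]; ring
    have h4 : ⟪y, η - ξ⟫ ≤ ρ * dist η ξ := by
      rw [dist_eq_norm, ← h]
      exact real_inner_le_norm _ _
    rw [lt_div_iff₀ (by positivity)] at hη1
    rw [inner_zero_left] at h1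
    nlinarith
  have hcrit : ∀ v : EuclideanSpace ℝ (Fin (m + 1)), v (Fin.last m) = 0 →
      ⟪v, η⟫ ≤ ⟪v, proj y⟫ := by
    intro v hv
    have hlc : ContinuousAt (fun s : ℝ => y + s • v) 0 := by fun_prop
    have hpc : ContinuousAt (fun s : ℝ => ⟪v, proj (y + s • v)⟫) 0 := by
      refine continuousAt_const.inner (ContinuousAt.comp (g := proj) ?_ hlc)
      simpa using hcont y hyB
    have hlim : Tendsto (fun s : ℝ => ⟪v, proj (y + s • v)⟫) (𝓝[>] 0) (𝓝 ⟪v, proj y⟫) := by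
      have := hpc.tendsto.mono_left (nhdsWithin_le_nhds (s := Ioi 0))
      simpa using this
    have hev : ∀ᶠ s : ℝ in 𝓝 0, y + s • v ∈ ball (0 : EuclideanSpace ℝ (Fin (m + 1))) ρ :=
      hlc.eventually (isOpen_ball.mem_nhds (by simpa using hylt))
    refine ge_of_tendsto hlim ?_
    filter_upwards [nhdsWithin_le_nhds hev, self_mem_nhdsWithin] with s hsB hs
    have hs : 0 < s := hs
    have h1 : ψ y - 2 * ⟪y, η⟫ ≤ ψ (y + s • v) - 2 * ⟪y + s • v, η⟫ :=
      hymin ⟨ball_subset_closedBall hsB, by simp [hH, hyH, hv]⟩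
    have h2 : ψ (y + s • v) + 2 * ⟪y - (y + s • v), proj (y + s • v)⟫ ≤ ψ y :=
      subgradient_of_mem_mproj (hmem _ (ball_subset_ball (by linarith) hsB))
    rw [inner_add_left, inner_smul_left] at h1
    rw [sub_add_cancel_left, inner_neg_left, inner_smul_left] at h2
    simp only [conj_trivial] at h1 h2
    exact le_of_mul_le_mul_left (by linarith) hs
  have hprojy : proj y = η := by
    have hcoord : ∀ i : Fin m, proj y i.castSucc = η i.castSucc := by
      intro i
      have h1 := hcrit (EuclideanSpace.single i.castSucc 1) (by simp)
      have h2 := hcrit (EuclideanSpace.single i.castSucc (-1)) (by simp)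
      rw [EuclideanSpace.inner_single_left, EuclideanSpace.inner_single_left] at h1 h2
      simp only [conj_trivial] at h1 h2
      linarith
    have hmy : proj y ∈ frontier Ω ∩ Uξ :=
      ⟨(hmem y hyB).1, hρU y (by rw [dist_zero_right]; linarith)⟩
    have hmη : η ∈ frontier Ω ∩ Uξ := ⟨hηf, hrUU hη2⟩
    rw [hgraph] at hmy hmη
    obtain ⟨z, -, hz⟩ := hmy
    obtain ⟨z', -, hz'⟩ := hmη
    have hzz : z = z' := by
      ext i
      have := hcoord i
      rwa [← hz, ← hz', snocE_castSucc, snocE_castSucc] at this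
    rw [← hz, ← hz', hzz]
  -- prolong the normal through `y` until it meets the sphere
  obtain ⟨w, hwy, hwb, hwm⟩ := exists_wbtw_mem_mproj isOpen_ball hproj hpos (y := y)
    (t := ε₁ + ρ) (by positivity) (closedBall_subset_ball' (by rw [dist_zero_right]; linarith))
  rw [hprojy] at hwb hwm
  have hwn : ε₁ ≤ ‖w‖ := by
    rw [dist_eq_norm] at hwy
    have := norm_sub_le w y
    linarith
  obtain ⟨z, hz, hzn⟩ := (convex_segment (𝕜 := ℝ) y w).isPreconnected.intermediate_value
    (left_mem_segment ℝ y w) (right_mem_segment ℝ y w) (f := norm) (by fun_prop)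
    (⟨by linarith, hwn⟩ : ε₁ ∈ Icc ‖y‖ ‖w‖)
  rw [mem_segment_iff_wbtw] at hz
  have hzB : z ∈ ball (0 : EuclideanSpace ℝ (Fin (m + 1))) ε₀ := by
    rw [mem_ball_zero_iff]; linarith
  have hzη : η ∈ mproj Ω z := mem_mproj_of_wbtw hwm (hwb.trans_right hz)
  refine ⟨z, ?_, ?_⟩
  · rw [hS]
    refine ⟨hzB, not_lt.1 fun hlt => ?_, hzn⟩
    obtain ⟨t, ⟨ht0, ht1⟩, hty⟩ := hwb.trans_right_left hz
    have hty' : (1 - t) * η (Fin.last m) + t * z (Fin.last m) = 0 := by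
      rw [← hyH, ← hty, AffineMap.lineMap_apply_module]
      simp
    rcases ht0.eq_or_lt with h | h
    · rw [← h] at hty'
      linarith
    · nlinarith [mul_pos h hlt, mul_nonneg (sub_nonneg.2 ht1) hηpos.le]
  · rw [hproj z hzB, mem_singleton_iff] at hzη
    rw [hproj z hzB, hzη]
end
end

section
/- Let Ω ⊂ ℝⁿ be a nonempty open convex set with nonempty boundary. Then every point η ∈ ∂Ω has non-spreading inner perpendicular. -/
open Set Metric Filter
open scoped RealInnerProductSpace ENNReal Topology

noncomputable section

/-- If every line in the direction `v` meets `Γ ∩ U` at most once, for some neighbourhood `U` of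
`η`, then `Γ` is locally a graph near `η` in the direction `v`. -/
theorem isGraphInDirection_of_unique {n : ℕ} {Γ U : Set (EuclideanSpace ℝ (Fin n))}
    {η v : EuclideanSpace ℝ (Fin n)} (hv : v ≠ 0) (hU : U ∈ 𝓝 η)
    (h : ∀ x ∈ Γ ∩ U, ∀ t : ℝ, x + t • v ∈ Γ ∩ U → t = 0) :
    IsGraphInDirection Γ η v := by
  have hg : ∀ z, ∃ t : ℝ, (∃ t' : ℝ, z + t' • v ∈ Γ ∩ U) → z + t • v ∈ Γ ∩ U := by
    intro z
    by_cases hz : ∃ t' : ℝ, z + t' • v ∈ Γ ∩ U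
    · exact ⟨hz.choose, fun _ => hz.choose_spec⟩
    · exact ⟨0, fun h' => absurd h' hz⟩
  choose g hg using hg
  refine ⟨U, hU, {z | ⟪z, v⟫ = 0 ∧ ∃ t : ℝ, z + t • v ∈ Γ ∩ U}, g, fun z hz => hz.1, ?_⟩
  apply Subset.antisymm
  · intro x hx
    set c : ℝ := ⟪x, v⟫ / ⟪v, v⟫ with hc
    have hxc : x - c • v + c • v = x := sub_add_cancel _ _
    have hex : ∃ t : ℝ, x - c • v + t • v ∈ Γ ∩ U := ⟨c, by rwa [hxc]⟩
    have hvv : ⟪v, v⟫ ≠ 0 := inner_self_ne_zero.mpr hv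
    refine ⟨x - c • v, ⟨?_, hex⟩, ?_⟩
    · rw [inner_sub_left, real_inner_smul_left, hc, div_mul_cancel₀ _ hvv, sub_self]
    · have hgx := hg _ hex
      have heq : x - c • v + g (x - c • v) • v = x + (g (x - c • v) - c) • v := by module
      rw [heq] at hgx
      have h0 := h x hx _ hgx
      change x - c • v + g (x - c • v) • v = x
      rw [heq, h0, zero_smul, add_zero]
  · rintro _ ⟨z, ⟨-, hz⟩, rfl⟩
    exact hg z hz

/-- A supporting functional at a nearest boundary point `η` of `y` is normal to the sphere around
`y` through `η`. -/
theorem inner_eq_norm_mul_norm_of_mem_mproj {n : ℕ} {Ω : Set (EuclideanSpace ℝ (Fin n))}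
    {y η w : EuclideanSpace ℝ (Fin n)} (hy : y ∈ Ω) (hη : η ∈ mproj Ω y)
    (hw : ∀ a ∈ Ω, ⟪w, a⟫ < ⟪w, η⟫) :
    ⟪w, η - y⟫ = ‖w‖ * ‖η - y‖ := by
  apply le_antisymm (real_inner_le_norm _ _)
  have hpos : 0 < ⟪w, η - y⟫ := by
    rw [inner_sub_right]
    exact sub_pos.mpr (hw y hy)
  have hw0 : w ≠ 0 := by
    rintro rfl
    simp at hpos
  have hnw : 0 < ‖w‖ := norm_pos_iff.mpr hw0
  set q := y + (⟪w, η - y⟫ / ‖w‖ ^ 2) • w with hq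
  have hqΩ : q ∈ Ωᶜ := by
    intro hqm
    have hlt := hw q hqm
    rw [hq, inner_add_right, real_inner_smul_right, real_inner_self_eq_norm_sq,
      div_mul_cancel₀ _ (by positivity), inner_sub_right] at hlt
    linarith
  obtain ⟨b, hb, hbd⟩ := exists_mem_frontier_infDist_compl_eq_dist hy
    (ne_univ_iff_exists_notMem Ω |>.mpr ⟨q, hqΩ⟩)
  have hdist : dist y η ≤ dist y q :=
    calc dist y η = infDist y (frontier Ω) := hη.2
      _ ≤ dist y b := infDist_le_dist_of_mem hb
      _ = infDist y Ωᶜ := hbd.symm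
      _ ≤ dist y q := infDist_le_dist_of_mem hqΩ
  rw [dist_comm y η, dist_eq_norm, hq, dist_self_add_right, norm_smul, Real.norm_eq_abs,
    abs_of_nonneg (by positivity)] at hdist
  calc ‖w‖ * ‖η - y‖ ≤ ‖w‖ * (⟪w, η - y⟫ / ‖w‖ ^ 2 * ‖w‖) := by gcongr
    _ = ⟪w, η - y⟫ := by field_simp

/-- A convex open set has no boundary point strictly between an inner point and a boundary
point. -/
theorem not_pos_of_mem_frontier_add_smul {E : Type*} [NormedAddCommGroup E] [NormedSpace ℝ E]
    {Ω : Set E} (hΩ : IsOpen Ω) (hconv : Convex ℝ Ω) {x v : E} {t : ℝ}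
    (hx : x ∈ frontier Ω) (hxv : x - v ∈ Ω) (hxt : x + t • v ∈ frontier Ω) : ¬ 0 < t := by
  intro ht
  have hmem : x ∈ openSegment ℝ (x - v) (x + t • v) := by
    refine ⟨t / (1 + t), 1 / (1 + t), by positivity, by positivity, by field_simp; ring, ?_⟩
    have hcoef : t / (1 + t) + 1 / (1 + t) = 1 := by field_simp; ring
    calc (t / (1 + t)) • (x - v) + (1 / (1 + t)) • (x + t • v)
        = (t / (1 + t) + 1 / (1 + t)) • x := by module
      _ = x := by rw [hcoef, one_smul]
  have hint := hconv.openSegment_interior_closure_subset_interior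
    (hΩ.interior_eq.symm ▸ hxv) (frontier_subset_closure hxt) hmem
  exact hx.2 hint

/-- **Remark 3.6 (second part).** Every boundary point of a nonempty open convex set has
non-spreading inner perpendicular. -/
theorem convex_nonSpreading (n : ℕ) (Ω : Set (EuclideanSpace ℝ (Fin n)))
    (hΩ : IsOpen Ω) (hconv : Convex ℝ Ω) (hΩne : Ω.Nonempty)
    (hne : (frontier Ω).Nonempty) :
    ∀ η ∈ frontier Ω, NonSpreadingPerp Ω η := by
  intro η hη
  rcases eq_empty_or_nonempty {y | y ∈ Ω ∧ mproj Ω y = {η}} with hem | ⟨y, hy, hyη⟩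
  · exact Or.inl hem
  have hηΩ : η ∉ Ω := fun h => hη.2 (hΩ.interior_eq.symm ▸ h)
  obtain ⟨f, hf⟩ := geometric_hahn_banach_open_point hconv hΩ hηΩ
  set w := (InnerProductSpace.toDual ℝ (EuclideanSpace ℝ (Fin n))).symm f with hw
  have hsupp : ∀ a ∈ Ω, ⟪w, a⟫ < ⟪w, η⟫ := by
    intro a ha
    simpa only [hw, InnerProductSpace.toDual_symm_apply] using hf a ha
  have hw0 : ‖w‖ ≠ 0 := by
    intro h
    have hlt := hsupp y hy
    rw [norm_eq_zero.mp h] at hlt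
    simp at hlt
  have hnormal : ∀ z ∈ Ω, mproj Ω z = {η} → η - z = (‖η - z‖ / ‖w‖) • w := by
    intro z hz hzη
    have hin := inner_eq_norm_mul_norm_of_mem_mproj hz (hzη ▸ mem_singleton η) hsupp
    have heq := inner_eq_norm_mul_iff_real.mp hin
    rw [div_eq_inv_mul, mul_smul, heq, smul_smul, inv_mul_cancel₀ hw0, one_smul]
  have hv : η - y ≠ 0 := fun h => hηΩ (sub_eq_zero.mp h ▸ hy)
  refine Or.inr ⟨η, η - y, hv, ?_, ?_⟩
  · rintro z ⟨hz, hzη⟩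
    refine ⟨-(‖η - z‖ / ‖η - y‖), ?_⟩
    have hny : ‖η - y‖ ≠ 0 := norm_ne_zero_iff.mpr hv
    have hscale : (‖η - z‖ / ‖η - y‖) • (η - y) = η - z := by
      nth_rewrite 2 [hnormal y hy hyη]
      rw [smul_smul, div_mul_div_cancel₀ hny, ← hnormal z hz hzη]
    rw [neg_smul, hscale]
    abel
  · have hU : (fun x => x - (η - y)) ⁻¹' Ω ∈ 𝓝 η :=
      (hΩ.preimage (by fun_prop)).mem_nhds (by simpa using hy)
    refine isGraphInDirection_of_unique hv hU ?_
    rintro x ⟨hx, hxU⟩ t ⟨hxt, hxtU⟩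
    apply le_antisymm
    · exact not_lt.mp (not_pos_of_mem_frontier_add_smul hΩ hconv hx hxU hxt)
    · have hback : x + t • (η - y) + (-t) • (η - y) ∈ frontier Ω := by
        rwa [neg_smul, add_neg_cancel_right]
      have := not_lt.mp (not_pos_of_mem_frontier_add_smul hΩ hconv hxt hxtU hback)
      linarith
end
end

section
/- Let Ω ⊂ ℝ² be the union of the open unit disc B₁(0) and the open upper half-plane {(x₁,x₂) : x₂ > 0}. Then: (i) the cut locus Σ̄ of Ω equals the nonnegative part of the x₂-axis, {(0,t) : t ≥ 0}; (ii) the point (1,1) belongs to Ω \ Σ̄ with π((1,1)) = {(1,0)}; and (iii) d((1,1)) = 1 = ρ*((1,0)). In particular, the strict inequality d(x) < ρ*(ξ) in the characterization of the cut locus fails for this Lipschitz domain. -/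
open Set Metric Filter
open scoped RealInnerProductSpace ENNReal Topology

noncomputable section

/-- The union of the open unit disc and the open upper half-plane in `ℝ²`. -/
def Ω₀ : Set (EuclideanSpace ℝ (Fin 2)) :=
  Metric.ball 0 1 ∪ {p : EuclideanSpace ℝ (Fin 2) | 0 < p 1}

/-- The point `(1, 1)`. -/
def pt11 : EuclideanSpace ℝ (Fin 2) :=
  EuclideanSpace.single 0 (1 : ℝ) + EuclideanSpace.single 1 (1 : ℝ)

/-- The point `(1, 0)`. -/
def pt10 : EuclideanSpace ℝ (Fin 2) := EuclideanSpace.single 0 (1 : ℝ)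

lemma dist_fin_two (x y : EuclideanSpace ℝ (Fin 2)) :
    dist x y = √((x 0 - y 0) ^ 2 + (x 1 - y 1) ^ 2) := by
  simp [EuclideanSpace.dist_eq, Real.dist_eq, sq_abs]

lemma dist_le_dist_fin_two_iff {x y z : EuclideanSpace ℝ (Fin 2)} :
    dist x y ≤ dist x z ↔
      (x 0 - y 0) ^ 2 + (x 1 - y 1) ^ 2 ≤ (x 0 - z 0) ^ 2 + (x 1 - z 1) ^ 2 := by
  rw [dist_fin_two, dist_fin_two, Real.sqrt_le_sqrt_iff (by positivity)]

lemma dist_lt_dist_fin_two_iff {x y z : EuclideanSpace ℝ (Fin 2)} :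
    dist x y < dist x z ↔
      (x 0 - y 0) ^ 2 + (x 1 - y 1) ^ 2 < (x 0 - z 0) ^ 2 + (x 1 - z 1) ^ 2 := by
  rw [← not_le, dist_le_dist_fin_two_iff, not_le]

lemma mem_ball_fin_two_iff {x z : EuclideanSpace ℝ (Fin 2)} {r : ℝ} (hr : 0 < r) :
    x ∈ Metric.ball z r ↔ (x 0 - z 0) ^ 2 + (x 1 - z 1) ^ 2 < r ^ 2 := by
  rw [Metric.mem_ball, dist_fin_two, Real.sqrt_lt' hr]

lemma ext_fin_two {x y : EuclideanSpace ℝ (Fin 2)} (h0 : x 0 = y 0) (h1 : x 1 = y 1) : x = y := by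
  ext i
  fin_cases i
  · exact h0
  · exact h1

lemma mem_Ω₀_iff {x : EuclideanSpace ℝ (Fin 2)} :
    x ∈ Ω₀ ↔ (x 0) ^ 2 + (x 1) ^ 2 < 1 ∨ 0 < x 1 := by
  simp [Ω₀, -Metric.mem_ball, mem_ball_fin_two_iff]

lemma continuous_coord (i : Fin 2) : Continuous fun p : EuclideanSpace ℝ (Fin 2) => p i := by
  fun_prop

lemma isOpen_Ω₀ : IsOpen Ω₀ :=
  Metric.isOpen_ball.union (isOpen_lt continuous_const (continuous_coord 1))

lemma closure_upper_half_plane :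
    closure {p : EuclideanSpace ℝ (Fin 2) | 0 < p 1} = {p | 0 ≤ p 1} := by
  have hopen : IsOpenMap (EuclideanSpace.proj 1 : EuclideanSpace ℝ (Fin 2) →L[ℝ] ℝ) :=
    ContinuousLinearMap.isOpenMap _ fun t => ⟨EuclideanSpace.single 1 t, by simp⟩
  have := hopen.preimage_closure_eq_closure_preimage
    (EuclideanSpace.proj 1 : EuclideanSpace ℝ (Fin 2) →L[ℝ] ℝ).continuous (Ioi 0)
  rw [closure_Ioi] at this
  exact this.symm

lemma mem_frontier_Ω₀_iff {x : EuclideanSpace ℝ (Fin 2)} :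
    x ∈ frontier Ω₀ ↔
      x 1 ≤ 0 ∧ 1 ≤ (x 0) ^ 2 + (x 1) ^ 2 ∧ (x 1 = 0 ∨ (x 0) ^ 2 + (x 1) ^ 2 = 1) := by
  have hball : x ∈ Metric.closedBall (0 : EuclideanSpace ℝ (Fin 2)) 1 ↔
      (x 0) ^ 2 + (x 1) ^ 2 ≤ 1 := by
    rw [Metric.mem_closedBall, dist_fin_two, Real.sqrt_le_one]
    simp
  rw [isOpen_Ω₀.frontier_eq, Set.mem_sdiff, mem_Ω₀_iff, Ω₀, closure_union,
    closure_ball _ one_ne_zero, closure_upper_half_plane, mem_union, hball, mem_ofPred_eq]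
  push Not
  constructor
  · rintro ⟨h | h, h1, h2⟩
    · exact ⟨h2, h1, Or.inr (le_antisymm h h1)⟩
    · exact ⟨h2, h1, Or.inl (le_antisymm h2 h)⟩
  · rintro ⟨h1, h2, h | h⟩
    · exact ⟨Or.inr h.ge, h2, h1⟩
    · exact ⟨Or.inl h.le, h2, h1⟩

lemma infDist_frontier_eq_of_forall_le {n : ℕ} {Ω : Set (EuclideanSpace ℝ (Fin n))}
    {x ξ : EuclideanSpace ℝ (Fin n)} (hξ : ξ ∈ frontier Ω)
    (h : ∀ η ∈ frontier Ω, dist x ξ ≤ dist x η) :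
    Metric.infDist x (frontier Ω) = dist x ξ :=
  le_antisymm (Metric.infDist_le_dist_of_mem hξ) ((Metric.le_infDist ⟨ξ, hξ⟩).2 fun η hη => h η hη)

lemma mproj_eq_singleton {n : ℕ} {Ω : Set (EuclideanSpace ℝ (Fin n))}
    {x ξ : EuclideanSpace ℝ (Fin n)} (hξ : ξ ∈ frontier Ω)
    (h : ∀ η ∈ frontier Ω, η ≠ ξ → dist x ξ < dist x η) : mproj Ω x = {ξ} := by
  have hinf : Metric.infDist x (frontier Ω) = dist x ξ :=
    infDist_frontier_eq_of_forall_le hξ fun η hη => by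
      by_cases he : η = ξ
      · rw [he]
      · exact (h η hη he).le
  ext η
  simp only [mproj, mem_ofPred_eq, mem_singleton_iff, hinf]
  refine ⟨fun ⟨hη, hd⟩ => ?_, fun he => by simp [he, hξ]⟩
  by_contra he
  exact (h η hη he).ne' hd

lemma mproj_Ω₀_of_one_le_sq {x : EuclideanSpace ℝ (Fin 2)} (h0 : 1 ≤ (x 0) ^ 2) (h1 : 0 < x 1) :
    mproj Ω₀ x = {!₂[x 0, 0]} := by
  refine mproj_eq_singleton (by simp [mem_frontier_Ω₀_iff, h0]) fun η hη hne => ?_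
  rw [dist_lt_dist_fin_two_iff]
  simp only [Matrix.cons_val_zero, Matrix.cons_val_one]
  obtain ⟨hη1, -, -⟩ := mem_frontier_Ω₀_iff.1 hη
  by_cases he : η 0 = x 0
  · have : η 1 < 0 := hη1.lt_of_ne fun h => hne (ext_fin_two (by simp [he]) (by simp [h]))
    nlinarith
  · have := sq_pos_of_ne_zero (sub_ne_zero.2 (Ne.symm he))
    nlinarith

/-- Here `s` is the sign of `x 0`. -/
lemma mproj_Ω₀_of_sq_lt_one {x : EuclideanSpace ℝ (Fin 2)} {s : ℝ} (hs : s ^ 2 = 1)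
    (hpos : 0 < s * x 0) (h0 : s * x 0 < 1) (h1 : 0 < x 1) : mproj Ω₀ x = {!₂[s, 0]} := by
  refine mproj_eq_singleton (by simp [mem_frontier_Ω₀_iff, hs]) fun η hη hne => ?_
  rw [dist_lt_dist_fin_two_iff]
  simp only [Matrix.cons_val_zero, Matrix.cons_val_one]
  obtain ⟨hη1, hη2, h⟩ := mem_frontier_Ω₀_iff.1 hη
  set a := s * x 0 with ha
  set b := s * η 0 with hb
  have hx : x 0 = s * a := by rw [ha, ← mul_assoc, ← sq, hs, one_mul]
  have hηb : η 0 = s * b := by rw [hb, ← mul_assoc, ← sq, hs, one_mul]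
  have hb2 : (η 0) ^ 2 = b ^ 2 := by rw [hηb, mul_pow, hs, one_mul]
  have e1 : (x 0 - s) ^ 2 = (a - 1) ^ 2 := by rw [hx]; linear_combination (a - 1) ^ 2 * hs
  have e2 : (x 0 - η 0) ^ 2 = (a - b) ^ 2 := by
    rw [hx, hηb]; linear_combination (a - b) ^ 2 * hs
  have hb1 : b ≠ 1 ∨ η 1 ≠ 0 := by
    by_contra! hcon
    exact hne (ext_fin_two (by simp [hηb, hcon.1]) (by simp [hcon.2]))
  rw [e1, e2]
  rw [hb2] at h hη2
  rcases h with h | h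
  · have hb1 : b ≠ 1 := by simpa [h] using hb1
    rw [h] at hη2 ⊢
    rcases le_or_gt 1 b with hb' | hb'
    · have : 1 < b := hb'.lt_of_ne hb1.symm
      nlinarith
    · have : b ≤ -1 := by nlinarith
      nlinarith
  · have hble : b ≤ 1 := by nlinarith [sq_nonneg (η 1)]
    rcases hble.lt_or_eq with hlt | heq
    · nlinarith [mul_pos hpos (sub_pos.2 hlt), mul_nonneg h1.le (neg_nonneg.2 hη1)]
    · exact absurd (by rw [heq] at h; nlinarith : η 1 = 0) (by simpa [heq] using hb1)

/-- Points of the lower half of the punctured disc project radially. -/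
lemma mproj_Ω₀_of_nonpos {x : EuclideanSpace ℝ (Fin 2)} (hne : x ≠ 0)
    (h1 : x 1 ≤ 0) (hlt : (x 0) ^ 2 + (x 1) ^ 2 < 1) : ∃ ξ, mproj Ω₀ x = {ξ} := by
  have hpos : 0 < (x 0) ^ 2 + (x 1) ^ 2 := by
    by_contra! hcon
    exact hne (ext_fin_two (by simp; nlinarith [sq_nonneg (x 1)])
      (by simp; nlinarith [sq_nonneg (x 0)]))
  set r := √((x 0) ^ 2 + (x 1) ^ 2) with hr
  have hr0 : 0 < r := Real.sqrt_pos.2 hpos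
  have hr2 : r ^ 2 = (x 0) ^ 2 + (x 1) ^ 2 := Real.sq_sqrt hpos.le
  have hr1 : r < 1 := by nlinarith
  obtain ⟨u, hu⟩ : ∃ u, x 0 = r * u := ⟨x 0 / r, by field_simp⟩
  obtain ⟨v, hv⟩ : ∃ v, x 1 = r * v := ⟨x 1 / r, by field_simp⟩
  have huv : u ^ 2 + v ^ 2 = 1 := by
    have : r ^ 2 * (u ^ 2 + v ^ 2) = r ^ 2 * 1 := by
      rw [mul_add, ← mul_pow, ← mul_pow, ← hu, ← hv, mul_one, hr2]
    exact mul_left_cancel₀ (by positivity) this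
  have hv0 : v ≤ 0 := by
    by_contra! hcon
    nlinarith [mul_pos hr0 hcon]
  refine ⟨!₂[u, v], mproj_eq_singleton (by simp [mem_frontier_Ω₀_iff, huv, hv0]) ?_⟩
  intro η hη hηne
  rw [dist_lt_dist_fin_two_iff]
  simp only [Matrix.cons_val_zero, Matrix.cons_val_one]
  obtain ⟨-, hη2, -⟩ := mem_frontier_Ω₀_iff.1 hη
  have hd : 0 < (η 0 - u) ^ 2 + (η 1 - v) ^ 2 := by
    by_contra! hcon
    exact hηne (ext_fin_two (by simp; nlinarith [sq_nonneg (η 0 - u), sq_nonneg (η 1 - v)])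
      (by simp; nlinarith [sq_nonneg (η 0 - u), sq_nonneg (η 1 - v)]))
  have key : (x 0 - η 0) ^ 2 + (x 1 - η 1) ^ 2 - ((x 0 - u) ^ 2 + (x 1 - v) ^ 2) =
      (1 - r) * ((η 0) ^ 2 + (η 1) ^ 2 - 1) + r * ((η 0 - u) ^ 2 + (η 1 - v) ^ 2) := by
    rw [hu, hv]
    linear_combination (r - 1) * huv
  have := mul_nonneg (sub_nonneg.2 hr1.le) (sub_nonneg.2 hη2)
  have := mul_pos hr0 hd
  linarith

lemma skel_Ω₀ : skel Ω₀ = {p : EuclideanSpace ℝ (Fin 2) | p 0 = 0 ∧ 0 ≤ p 1} := by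
  ext x
  simp only [skel, mem_ofPred_eq]
  constructor
  · rintro ⟨hx, hns⟩
    by_contra hcon
    apply hns
    rcases le_or_gt (x 1) 0 with h1 | h1
    · refine mproj_Ω₀_of_nonpos ?_ h1 ((mem_Ω₀_iff.1 hx).resolve_right h1.not_gt)
      rintro rfl
      simp at hcon
    · have h0 : x 0 ≠ 0 := fun h => hcon ⟨h, h1.le⟩
      by_cases hle : 1 ≤ (x 0) ^ 2
      · exact ⟨_, mproj_Ω₀_of_one_le_sq hle h1⟩
      · rcases h0.lt_or_gt with hneg | hpos
        · exact ⟨_, mproj_Ω₀_of_sq_lt_one (s := -1) (by norm_num) (by linarith)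
            (by nlinarith) h1⟩
        · exact ⟨_, mproj_Ω₀_of_sq_lt_one (s := 1) (by norm_num) (by linarith)
            (by nlinarith) h1⟩
  · rintro ⟨h0, h1⟩
    refine ⟨mem_Ω₀_iff.2 ?_, ?_⟩
    · rcases h1.eq_or_lt with h | h
      · left; simp [h0, ← h]
      · exact Or.inr h
    have hmem : ∀ s : ℝ, s ^ 2 = 1 → (!₂[s, 0] : EuclideanSpace ℝ (Fin 2)) ∈ mproj Ω₀ x := by
      intro s hs
      have hf : (!₂[s, 0] : EuclideanSpace ℝ (Fin 2)) ∈ frontier Ω₀ := by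
        simp [mem_frontier_Ω₀_iff, hs]
      refine ⟨hf, (infDist_frontier_eq_of_forall_le hf fun η hη => ?_).symm⟩
      obtain ⟨hη1, hη2, -⟩ := mem_frontier_Ω₀_iff.1 hη
      rw [dist_le_dist_fin_two_iff]
      simp only [Matrix.cons_val_zero, Matrix.cons_val_one, h0]
      nlinarith [mul_nonneg h1 (neg_nonneg.2 hη1)]
    rintro ⟨ξ, hξ⟩
    have hp := hmem 1 (by norm_num)
    have hm := hmem (-1) (by norm_num)
    rw [hξ, mem_singleton_iff] at hp hm
    have := congrArg (fun p : EuclideanSpace ℝ (Fin 2) => p 0) (hp.trans hm.symm)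
    norm_num at this

lemma cutLocus_Ω₀ : cutLocus Ω₀ = {p : EuclideanSpace ℝ (Fin 2) | p 0 = 0 ∧ 0 ≤ p 1} := by
  have hclosed : IsClosed {p : EuclideanSpace ℝ (Fin 2) | p 0 = 0 ∧ 0 ≤ p 1} :=
    (isClosed_eq (continuous_coord 0) continuous_const).inter
      (isClosed_le continuous_const (continuous_coord 1))
  have hsub : skel Ω₀ ⊆ Ω₀ := fun x hx => hx.1
  rw [skel_Ω₀] at hsub
  rw [cutLocus, skel_Ω₀, hclosed.closure_eq, inter_eq_right.2 hsub]

lemma one_le_rho_Ω₀ {η : EuclideanSpace ℝ (Fin 2)} (hη : η ∈ frontier Ω₀) : 1 ≤ rho Ω₀ η := by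
  suffices h : ∃ z, dist η z = 1 ∧ Metric.ball z 1 ⊆ Ω₀ by
    obtain ⟨z, hz, hsub⟩ := h
    rw [← ENNReal.ofReal_one]
    exact le_iSup_of_le 1 (le_iSup₂_of_le z
      ⟨one_pos, hz, univ, univ_mem, inter_subset_inter_left _ hsub⟩ le_rfl)
  obtain ⟨-, -, h | h⟩ := mem_frontier_Ω₀_iff.1 hη
  · refine ⟨!₂[η 0, 1], by simp [dist_fin_two, h], fun p hp => mem_Ω₀_iff.2 (Or.inr ?_)⟩
    rw [mem_ball_fin_two_iff one_pos] at hp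
    simp only [Matrix.cons_val_zero, Matrix.cons_val_one] at hp
    nlinarith [sq_nonneg (p 0 - η 0), sq_nonneg (p 1)]
  · exact ⟨0, by rw [dist_fin_two]; simp [h], subset_union_left⟩

/-- A curve issuing from a boundary point into the touching ball cannot avoid the unit disc. -/
lemma not_innerTouchBall_Ω₀_of_curve {η z : EuclideanSpace ℝ (Fin 2)} {r : ℝ} (hη : η 1 < 0)
    {p : ℝ → EuclideanSpace ℝ (Fin 2)} (hp : Continuous p) (hp0 : p 0 = η)
    (hdisc : ∀ᶠ t in 𝓝[>] (0 : ℝ), 1 ≤ (p t 0) ^ 2 + (p t 1) ^ 2)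
    (hball : ∀ᶠ t in 𝓝[>] (0 : ℝ), (p t 0 - z 0) ^ 2 + (p t 1 - z 1) ^ 2 < r ^ 2) :
    ¬ InnerTouchBall Ω₀ η z r := by
  rintro ⟨hr, -, U, hU, hsub⟩
  have htend : Tendsto p (𝓝[>] 0) (𝓝 η) := hp0 ▸ hp.continuousWithinAt
  have hlow : ∀ᶠ q in 𝓝 η, q 1 < 0 :=
    (continuous_coord 1).continuousAt.eventually_lt continuousAt_const hη
  obtain ⟨t, h1, h2, h3, h4⟩ :=
    (hdisc.and (hball.and ((htend.eventually hU).and (htend.eventually hlow)))).exists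
  rcases mem_Ω₀_iff.1 (hsub ⟨(mem_ball_fin_two_iff hr).2 h2, h3⟩).1 with h | h
  · exact h1.not_gt h
  · exact h4.not_gt h

/-- `(c, d)` is a unit tangent vector of the circle at `η`, chosen so that `z - η` has a
nonnegative tangential component. -/
lemma not_innerTouchBall_Ω₀_of_tangent {η z : EuclideanSpace ℝ (Fin 2)} {r c d : ℝ}
    (hη : η 1 < 0) (hcirc : (η 0) ^ 2 + (η 1) ^ 2 = 1) (hcd : c ^ 2 + d ^ 2 = 1)
    (hperp : c * η 0 + d * η 1 = 0)
    (hr : (η 0 - z 0) ^ 2 + (η 1 - z 1) ^ 2 = r ^ 2)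
    (hcase : 0 < c * (z 0 - η 0) + d * (z 1 - η 1) ∨
      c * (z 0 - η 0) + d * (z 1 - η 1) = 0 ∧ η 0 * (z 0 - η 0) + η 1 * (z 1 - η 1) < -1) :
    ¬ InnerTouchBall Ω₀ η z r := by
  set α := η 0 * (z 0 - η 0) + η 1 * (z 1 - η 1) with hα
  set β := c * (z 0 - η 0) + d * (z 1 - η 1) with hβ
  refine not_innerTouchBall_Ω₀_of_curve hη
    (p := fun t => !₂[η 0 + t * c - t ^ 2 / 2 * η 0, η 1 + t * d - t ^ 2 / 2 * η 1])
    (by fun_prop) (ext_fin_two (by simp) (by simp)) (Eventually.of_forall fun t => ?_) ?_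
  · simp only [Matrix.cons_val_zero, Matrix.cons_val_one]
    have : (η 0 + t * c - t ^ 2 / 2 * η 0) ^ 2 + (η 1 + t * d - t ^ 2 / 2 * η 1) ^ 2
        = 1 + t ^ 4 / 4 := by
      linear_combination (1 - t ^ 2 / 2) ^ 2 * hcirc + t ^ 2 * hcd +
        2 * t * (1 - t ^ 2 / 2) * hperp
    rw [this]
    have : 0 ≤ t ^ 4 := by positivity
    linarith
  · have hlt : ∀ᶠ t in 𝓝[>] (0 : ℝ), (α + 1) * t ^ 2 + t ^ 4 / 4 < 2 * t * β := by
      rcases hcase with hpos | ⟨hzero, hneg⟩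
      · have hc : ContinuousAt (fun t : ℝ => (α + 1) * t + t ^ 3 / 4) 0 := by fun_prop
        have := hc.eventually_lt (g := fun _ => 2 * β) continuousAt_const (by simpa using hpos)
        filter_upwards [this.filter_mono nhdsWithin_le_nhds, self_mem_nhdsWithin] with t ht ht0
        have := mul_lt_mul_of_pos_left ht ht0
        linarith
      · have hc : ContinuousAt (fun t : ℝ => (α + 1) + t ^ 2 / 4) 0 := by fun_prop
        have := hc.eventually_lt (g := fun _ => 0) continuousAt_const (by simp; linarith)
        filter_upwards [this.filter_mono nhdsWithin_le_nhds, self_mem_nhdsWithin] with t ht ht0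
        rw [hzero]
        have := mul_lt_mul_of_pos_left ht (pow_pos ht0 2)
        linarith
    filter_upwards [hlt] with t ht
    simp only [Matrix.cons_val_zero, Matrix.cons_val_one]
    have : (η 0 + t * c - t ^ 2 / 2 * η 0 - z 0) ^ 2 +
        (η 1 + t * d - t ^ 2 / 2 * η 1 - z 1) ^ 2
        = r ^ 2 + ((α + 1) * t ^ 2 + t ^ 4 / 4 - 2 * t * β) := by
      rw [hα, hβ]
      linear_combination hr + t ^ 4 / 4 * hcirc + t ^ 2 * hcd - t ^ 3 * hperp
    linarith

lemma rho_Ω₀_le_one {η : EuclideanSpace ℝ (Fin 2)} (hη : η 1 < 0)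
    (hcirc : (η 0) ^ 2 + (η 1) ^ 2 = 1) : rho Ω₀ η ≤ 1 := by
  refine iSup_le fun r => iSup₂_le fun z hz => ENNReal.ofReal_le_one.2 ?_
  by_contra! hr1
  have hr0 : 0 < r := hz.1
  have hr : (η 0 - z 0) ^ 2 + (η 1 - z 1) ^ 2 = r ^ 2 := by
    rw [← hz.2.1, dist_fin_two, Real.sq_sqrt (by positivity)]
  set α := η 0 * (z 0 - η 0) + η 1 * (z 1 - η 1) with hα
  set β := -η 1 * (z 0 - η 0) + η 0 * (z 1 - η 1) with hβ
  have hsum : α ^ 2 + β ^ 2 = r ^ 2 := by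
    rw [hα, hβ]
    linear_combination ((η 0 - z 0) ^ 2 + (η 1 - z 1) ^ 2) * hcirc + hr
  rcases lt_trichotomy β 0 with hneg | hzero | hpos
  · exact not_innerTouchBall_Ω₀_of_tangent (c := η 1) (d := -η 0) hη hcirc (by linarith)
      (by ring) hr (Or.inl (by linarith)) hz
  · rcases lt_or_ge α (-1) with hlt | hge
    · exact not_innerTouchBall_Ω₀_of_tangent (c := -η 1) (d := η 0) hη hcirc (by linarith)
        (by ring) hr (Or.inr ⟨hzero, hlt⟩) hz
    · have hαr : α = r := by
        rw [hzero] at hsum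
        have : (α - r) * (α + r) = 0 := by linarith
        rcases mul_eq_zero.1 this with h | h <;> linarith
      refine not_innerTouchBall_Ω₀_of_curve hη (p := fun t => (1 + t) • η) (by fun_prop)
        (by simp) ?_ ?_ hz
      · filter_upwards [self_mem_nhdsWithin] with t (ht : 0 < t)
        simp only [PiLp.smul_apply, smul_eq_mul]
        rw [mul_pow, mul_pow, ← mul_add, hcirc]
        nlinarith
      · filter_upwards [Ioo_mem_nhdsGT hr0] with t ht
        simp only [PiLp.smul_apply, smul_eq_mul]
        have : ((1 + t) * η 0 - z 0) ^ 2 + ((1 + t) * η 1 - z 1) ^ 2 =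
            r ^ 2 + t * (t - 2 * α) := by
          rw [hα]
          linear_combination hr + t ^ 2 * hcirc
        rw [this, hαr]
        nlinarith [mul_pos ht.1 (sub_pos.2 ht.2), mul_pos ht.1 hr0]
  · exact not_innerTouchBall_Ω₀_of_tangent (c := -η 1) (d := η 0) hη hcirc (by linarith)
      (by ring) hr (Or.inl hpos) hz

lemma rhoStar_Ω₀_pt10 : rhoStar Ω₀ pt10 = 1 := by
  refine le_antisymm (iSup₂_le fun ε hε => ?_)
    (le_iSup₂_of_le 1 one_pos (le_iInf₂ fun η hη => one_le_rho_Ω₀ hη.2))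
  let p : ℝ → EuclideanSpace ℝ (Fin 2) := fun θ => !₂[Real.cos θ, -Real.sin θ]
  have hp : Continuous p := by fun_prop
  have hp0 : p 0 = pt10 := ext_fin_two (by simp [p, pt10]) (by simp [p, pt10])
  have htend : Tendsto p (𝓝[>] 0) (𝓝 pt10) := hp0 ▸ hp.continuousWithinAt
  obtain ⟨θ, h1, h2⟩ := ((htend.eventually (Metric.ball_mem_nhds _ hε)).and
    (Ioo_mem_nhdsGT Real.pi_pos)).exists
  have hsin : 0 < Real.sin θ := Real.sin_pos_of_mem_Ioo h2
  refine iInf₂_le_of_le (p θ) ⟨h1, mem_frontier_Ω₀_iff.2 ?_⟩ (rho_Ω₀_le_one ?_ ?_)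
  · simp [p, hsin.le]
  · simpa [p] using hsin
  · simp [p]

/-- **§4 counterexample.** For the Lipschitz domain `Ω₀` (unit disc ∪ upper half-plane):
(i) the cut locus is the nonnegative part of the `x₂`-axis; (ii) `(1,1) ∈ Ω₀ \ Σ̄` with
`π((1,1)) = {(1,0)}`; and (iii) `d((1,1)) = 1 = ρ*((1,0))`, so the strict inequality
`d(x) < ρ*(ξ)` characterizing the complement of the cut locus fails. -/
theorem counterexample_lipschitz :
    cutLocus Ω₀ = {p : EuclideanSpace ℝ (Fin 2) | p 0 = 0 ∧ 0 ≤ p 1} ∧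
    pt11 ∈ Ω₀ \ cutLocus Ω₀ ∧
    mproj Ω₀ pt11 = {pt10} ∧
    Metric.infDist pt11 (frontier Ω₀) = 1 ∧
    rhoStar Ω₀ pt10 = 1 ∧
    ¬ ENNReal.ofReal (Metric.infDist pt11 (frontier Ω₀)) < rhoStar Ω₀ pt10 := by
  have h10 : (!₂[pt11 0, 0] : EuclideanSpace ℝ (Fin 2)) = pt10 :=
    ext_fin_two (by simp [pt11, pt10]) (by simp [pt10])
  have hproj : mproj Ω₀ pt11 = {pt10} :=
    h10 ▸ mproj_Ω₀_of_one_le_sq (by simp [pt11]) (by simp [pt11])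
  have hdist : Metric.infDist pt11 (frontier Ω₀) = 1 := by
    have hmem : pt10 ∈ mproj Ω₀ pt11 := hproj ▸ mem_singleton _
    rw [← hmem.2]
    simp [pt11, pt10]
  refine ⟨cutLocus_Ω₀, ⟨mem_Ω₀_iff.2 (Or.inr (by simp [pt11])), ?_⟩, hproj, hdist,
    rhoStar_Ω₀_pt10, by simp [hdist, rhoStar_Ω₀_pt10]⟩
  simp [cutLocus_Ω₀, pt11]
end
end
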